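/- Let $(X,\mathcal{B}_X,\mu,T)$ be a $\mathbb{Z}^q$-MPS ($q\ge 2$), $\vec v=(1,\beta_2,\dots,\beta_q)\in\mathbb{R}^q$ a direction vector and $\mathbf{b}=(b_2,\dots,b_q)$ with all $b_i>0$. For every finite measurable partition $\alpha$ of $X$: (i) for every infinite subset $S'$ of $\Lambda^{\vec v}(\mathbf{b})$, $h^{S'}_\mu(T,\alpha)\le H_\mu(\alpha\mid\mathcal{K}^{\vec v}_\mu)$; and (ii) there exists an infinite subset $S=\{\vec w_i=(m_1^{(i)},\dots,m_q^{(i)})\}_{i=1}^\infty$ of $\Lambda^{\vec v}(\mathbf{b})$ with $\{m_1^{(i)}\}_{i=1}^\infty$ strictly monotone such that $h^S_\mu(T,\alpha)=H_\mu(\alpha\mid\mathcal{K}^{\vec v}_\mu)$. -/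

import Mathlib

open MeasureTheory Filter Set
open scoped ENNReal Topology

namespace Directional

noncomputable section

attribute [local instance] Classical.propDecidable

variable {X : Type*} [MeasurableSpace X] {G : Type*}

/-- The set of Koopman images `U_T^w 1_B` for `w ∈ Λ`, as elements of `L²(μ)`. -/
def korbit (μ : Measure X) (T : G → X → X) (Λ : Set G) (B : Set X) :
    Set (Lp ℝ 2 μ) :=
  {g | ∃ w ∈ Λ, (g : X → ℝ) =ᵐ[μ] fun x => B.indicator (fun _ => (1 : ℝ)) (T w x)}

/-- A finite measurable partition of `X`. -/
def IsPartition (α : Finset (Set X)) : Prop :=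
  (∀ A ∈ α, MeasurableSet A) ∧ ((α : Set (Set X)).PairwiseDisjoint id) ∧
    ⋃₀ (α : Set (Set X)) = Set.univ

/-- Static entropy `H_μ(α) = -∑ μ(A) log μ(A)`. -/
def partEnt (μ : Measure X) (α : Finset (Set X)) : ℝ :=
  ∑ A ∈ α, Real.negMulLog (μ A).toReal

/-- The join `⋁_{i=1}^k T^{-w_i} α`. -/
def seqJoin (T : G → X → X) (w : ℕ → G) (α : Finset (Set X)) : ℕ → Finset (Set X)
  | 0 => {Set.univ}
  | k + 1 => ((seqJoin T w α k) ×ˢ α).image fun p => p.1 ∩ (T (w k) ⁻¹' p.2)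

/-- Sequence entropy `h^S_μ(T, α)` along the sequence `w` for the partition `α`. -/
def seqEnt (μ : Measure X) (T : G → X → X) (w : ℕ → G) (α : Finset (Set X)) : ℝ :=
  Filter.atTop.limsup fun k : ℕ => partEnt μ (seqJoin T w α k) / (k : ℝ)

/-- Sequence entropy `h^S_μ(T)`, as the supremum over all finite measurable
partitions (valued in `ℝ≥0∞`). -/
def seqEntSup (μ : Measure X) (T : G → X → X) (w : ℕ → G) : ℝ≥0∞ :=
  ⨆ α : {α : Finset (Set X) // IsPartition α}, ENNReal.ofReal (seqEnt μ T w α)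

/-- `w : ℕ → G` is an enumeration of an infinite subset of `Λ`. -/
def EnumIn (w : ℕ → G) (Λ : Set G) : Prop :=
  Function.Injective w ∧ ∀ i, w i ∈ Λ

/-- Conditional entropy `H_μ(α | F)` with respect to a sub-σ-algebra `F`. -/
def condEntAlg (μ : Measure X) (F : MeasurableSpace X) (α : Finset (Set X)) : ℝ :=
  ∑ A ∈ α, ∫ x, Real.negMulLog ((μ[A.indicator (fun _ => (1 : ℝ)) | F]) x) ∂μ

/-- Conditional entropy `H_μ(α | η)` of a partition given another partition. -/
def condEntPart (μ : Measure X) (α η : Finset (Set X)) : ℝ :=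
  -∑ A ∈ α, ∑ D ∈ η,
    (μ (A ∩ D)).toReal * Real.log ((μ (A ∩ D)).toReal / (μ D).toReal)

/-- A `ℤ²`-measure-preserving system: an action of `ℤ²` by homeomorphisms
(continuous maps with continuous inverses `T (-w)`), preserving `μ`. -/
def IsZ2MPS [TopologicalSpace X] (μ : Measure X) (T : ℤ × ℤ → X → X) : Prop :=
  (∀ w, Continuous (T w)) ∧ T 0 = _root_.id ∧ (∀ v w, T (v + w) = T v ∘ T w) ∧
    ∀ w, MeasurePreserving (T w) μ μ

/-- The strip `Λ^{(1,β)}(b) = {(m,n) : βm - b/2 ≤ n ≤ βm + b/2}`. -/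
def Lam (β b : ℝ) : Set (ℤ × ℤ) :=
  {p | β * (p.1 : ℝ) - b / 2 ≤ (p.2 : ℝ) ∧ (p.2 : ℝ) ≤ β * (p.1 : ℝ) + b / 2}

/-- The `(1,β)`-directional Kronecker algebra with width parameter `b`. -/
def dirKron (μ : Measure X) (T : ℤ × ℤ → X → X) (β b : ℝ) : Set (Set X) :=
  {B | MeasurableSet B ∧ IsCompact (closure (korbit μ T (Lam β b) B))}

/-- The directional Kronecker algebra as a σ-algebra (using width `b = 1`,
which is immaterial since `dirKron` is independent of `b`). -/
def dirKronAlg (μ : Measure X) (T : ℤ × ℤ → X → X) (β : ℝ) : MeasurableSpace X :=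
  MeasurableSpace.generateFrom (dirKron μ T β 1)

/-- The classical Kronecker algebra of the `ℤ²`-system. -/
def kron (μ : Measure X) (T : ℤ × ℤ → X → X) : Set (Set X) :=
  {B | MeasurableSet B ∧ IsCompact (closure (korbit μ T Set.univ B))}

/-- `h^{v,*}_μ(α)`: supremum of directional sequence entropies of `α` over all
infinite subsets of the strip (width `1`, immaterial). -/
def hStar (μ : Measure X) (T : ℤ × ℤ → X → X) (β : ℝ) (α : Finset (Set X)) : ℝ :=
  ⨆ w : {w : ℕ → ℤ × ℤ // EnumIn w (Lam β 1)}, seqEnt μ T w.1 α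

/-- The two-element partition `{B, Bᶜ}`. -/
def pairPart (B : Set X) : Finset (Set X) := {B, Bᶜ}

/-- The pulled-back partition `T^{-g} α = {T_g⁻¹ A : A ∈ α}`. -/
def pullPart (T : G → X → X) (g : G) (α : Finset (Set X)) : Finset (Set X) :=
  α.image fun A => T g ⁻¹' A

end

section Zq

variable {X : Type*} [MeasurableSpace X] {q : ℕ} [NeZero q]

/-- A `ℤ^q`-measure-preserving system: an action of `ℤ^q` by homeomorphisms
preserving `μ`. -/
def IsZqMPS [TopologicalSpace X] (μ : Measure X) (T : (Fin q → ℤ) → X → X) : Prop :=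
  (∀ w, Continuous (T w)) ∧ T 0 = _root_.id ∧ (∀ v w, T (v + w) = T v ∘ T w) ∧
    ∀ w, MeasurePreserving (T w) μ μ

/-- The tube `Λ^{(1,β₂,…,β_q)}(b) ⊆ ℤ^q`. -/
def LamQ (β b : Fin q → ℝ) : Set (Fin q → ℤ) :=
  {w | ∀ i : Fin q, i ≠ 0 →
    (β i * (w 0 : ℝ) - b i / 2 ≤ (w i : ℝ) ∧ (w i : ℝ) ≤ β i * (w 0 : ℝ) + b i / 2)}

/-- The directional Kronecker algebra of a `ℤ^q`-system along `(1,β₂,…,β_q)`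
with width parameter `b`. -/
def dirKronQ (μ : Measure X) (T : (Fin q → ℤ) → X → X) (β b : Fin q → ℝ) :
    Set (Set X) :=
  {B | MeasurableSet B ∧ IsCompact (closure (korbit μ T (LamQ β b) B))}

/-- The directional Kronecker algebra as a σ-algebra (width `1`, immaterial). -/
def dirKronAlgQ (μ : Measure X) (T : (Fin q → ℤ) → X → X) (β : Fin q → ℝ) :
    MeasurableSpace X :=
  MeasurableSpace.generateFrom (dirKronQ μ T β fun _ => 1)

/-- The classical Kronecker algebra of a `ℤ^q`-system. -/
def kronQ (μ : Measure X) (T : (Fin q → ℤ) → X → X) : Set (Set X) :=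
  {B | MeasurableSet B ∧ IsCompact (closure (korbit μ T Set.univ B))}

/-- `h^{v,*}_μ(α)` for a `ℤ^q`-system: the supremum of directional sequence
entropies of `α` over all infinite subsets of the tube (width `1`,
immaterial). -/
noncomputable def hStarQ (μ : Measure X) (T : (Fin q → ℤ) → X → X) (β : Fin q → ℝ)
    (α : Finset (Set X)) : ℝ :=
  ⨆ w : {w : ℕ → Fin q → ℤ // EnumIn w (LamQ β fun _ => 1)}, seqEnt μ T w.1 α

end Zq

set_option linter.unusedSectionVars false

/-! ### Finite colourings and total boundedness -/

/-- For every `ε > 0` the set `S` has a finite colouring whose colour classes have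
`d`-diameter at most `ε`. -/
def FinColorable {G : Type*} (S : Set G) (d : G → G → ℝ) : Prop :=
  ∀ ε > 0, ∃ (k : ℕ) (c : G → Fin k), ∀ u ∈ S, ∀ v ∈ S, c u = c v → d u v ≤ ε

theorem FinColorable.of_finite {G : Type*} {S : Set G} {d : G → G → ℝ}
    (h : ∀ ε > 0, ∃ (ι : Type) (_ : Finite ι) (c : G → ι),
      ∀ u ∈ S, ∀ v ∈ S, c u = c v → d u v ≤ ε) : FinColorable S d := by
  intro ε hε
  obtain ⟨ι, _, c, hc⟩ := h ε hε
  exact ⟨Nat.card ι, fun u => Finite.equivFin ι (c u), fun u hu v hv huv =>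
    hc u hu v hv ((Finite.equivFin ι).injective huv)⟩

theorem FinColorable.mono {G : Type*} {S S' : Set G} {d d' : G → G → ℝ} (h : FinColorable S d)
    (hS : S' ⊆ S) (hd : ∀ u ∈ S', ∀ v ∈ S', d' u v ≤ d u v) : FinColorable S' d' := by
  intro ε hε
  obtain ⟨k, c, hc⟩ := h ε hε
  exact ⟨k, c, fun u hu v hv huv => (hd u hu v hv).trans (hc u (hS hu) v (hS hv) huv)⟩

theorem FinColorable.sum {G ι : Type*} [Fintype ι] {S : Set G} {d : ι → G → G → ℝ}
    (h : ∀ i, FinColorable S (d i)) : FinColorable S (fun u v => ∑ i, d i u v) := by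
  intro ε hε
  have hε' : 0 < ε / (Fintype.card ι + 1) := by positivity
  choose k c hc using fun i => h i _ hε'
  refine ⟨Nat.card (∀ i, Fin (k i)), fun u => Finite.equivFin _ fun i => c i u,
    fun u hu v hv huv => ?_⟩
  have huv' := (Finite.equivFin (∀ i, Fin (k i))).injective huv
  calc ∑ i, d i u v ≤ ∑ _i : ι, ε / (Fintype.card ι + 1) :=
        Finset.sum_le_sum fun i _ => hc i u hu v hv (congrFun huv' i)
    _ = Fintype.card ι * (ε / (Fintype.card ι + 1)) := by simp
    _ ≤ ε := by
        rw [mul_div_assoc', div_le_iff₀ (by positivity)]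
        nlinarith

theorem FinColorable.add {G : Type*} {S : Set G} {d d' : G → G → ℝ}
    (h : FinColorable S d) (h' : FinColorable S d') :
    FinColorable S (fun u v => d u v + d' u v) := by
  have := FinColorable.sum (ι := Bool) (d := fun b => cond b d d') (S := S)
    (by rintro (_ | _) <;> assumption)
  simpa using this

theorem FinColorable.const_mul {G : Type*} {S : Set G} {d : G → G → ℝ}
    (h : FinColorable S d) {C : ℝ} (hC : 0 ≤ C) : FinColorable S (fun u v => C * d u v) := by
  intro ε hε
  obtain ⟨k, c, hc⟩ := h (ε / (C + 1)) (by positivity)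
  refine ⟨k, c, fun u hu v hv huv => ?_⟩
  calc C * d u v ≤ C * (ε / (C + 1)) := mul_le_mul_of_nonneg_left (hc u hu v hv huv) hC
    _ ≤ ε := by
      rw [mul_div_assoc', div_le_iff₀ (by positivity)]
      nlinarith

theorem FinColorable.of_approx {G : Type*} {S : Set G} {d : G → G → ℝ}
    (h : ∀ ε > 0, ∃ d' : G → G → ℝ, FinColorable S d' ∧
      ∀ u ∈ S, ∀ v ∈ S, d u v ≤ d' u v + ε) : FinColorable S d := by
  intro ε hε
  obtain ⟨d', hd', hd⟩ := h (ε / 2) (by positivity)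
  obtain ⟨k, c, hc⟩ := hd' (ε / 2) (by positivity)
  exact ⟨k, c, fun u hu v hv huv => by
    have h1 := hd u hu v hv
    have h2 := hc u hu v hv huv
    linarith⟩

theorem FinColorable.of_sq {G : Type*} {S : Set G} {d : G → G → ℝ}
    (h : FinColorable S (fun u v => d u v ^ 2)) : FinColorable S d := by
  intro ε hε
  obtain ⟨k, c, hc⟩ := h (ε ^ 2) (by positivity)
  exact ⟨k, c, fun u hu v hv huv => le_of_sq_le_sq (hc u hu v hv huv) hε.le⟩

theorem FinColorable.sq {G : Type*} {S : Set G} {d : G → G → ℝ} (hd : ∀ u v, 0 ≤ d u v)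
    (h : FinColorable S d) : FinColorable S (fun u v => d u v ^ 2) := by
  intro ε hε
  obtain ⟨k, c, hc⟩ := h (√ε) (by positivity)
  exact ⟨k, c, fun u hu v hv huv => by
    calc d u v ^ 2 ≤ (√ε) ^ 2 := pow_le_pow_left₀ (hd u v) (hc u hu v hv huv) 2
      _ = ε := Real.sq_sqrt hε.le⟩

theorem FinColorable.of_totallyBounded {G E : Type*} [PseudoMetricSpace E] {S : Set G}
    {F : G → E} (h : TotallyBounded (F '' S)) : FinColorable S (fun u v => dist (F u) (F v)) := by
  intro ε hε
  obtain ⟨t, ht, hcov⟩ := Metric.totallyBounded_iff.mp h (ε / 2) (by positivity)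
  have : Finite t := ht
  have hex : ∀ u, ∃ o : Option t, u ∈ S → ∃ y, o = some y ∧ dist (F u) y < ε / 2 := by
    intro u
    by_cases hu : u ∈ S
    · obtain ⟨y, hy, hy'⟩ := mem_iUnion₂.mp (hcov (mem_image_of_mem F hu))
      exact ⟨some ⟨y, hy⟩, fun _ => ⟨⟨y, hy⟩, rfl, hy'⟩⟩
    · exact ⟨none, fun h => absurd h hu⟩
  choose o ho using hex
  refine ⟨Nat.card (Option t), fun u => Finite.equivFin _ (o u), fun u hu v hv huv => ?_⟩
  have huv' := (Finite.equivFin (Option t)).injective huv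
  obtain ⟨y, hy, hyd⟩ := ho u hu
  obtain ⟨z, hz, hzd⟩ := ho v hv
  have hyz : y = z := by
    rw [hy, hz] at huv'
    exact Option.some.inj huv'
  subst hyz
  have := dist_triangle_right (F u) (F v) y
  linarith

theorem FinColorable.totallyBounded {G E : Type*} [PseudoMetricSpace E] {S : Set G}
    {F : G → E} (h : FinColorable S (fun u v => dist (F u) (F v))) :
    TotallyBounded (F '' S) := by
  refine Metric.totallyBounded_iff.mpr fun ε hε => ?_
  obtain ⟨k, c, hc⟩ := h (ε / 2) (by positivity)
  have hex : ∀ i : Fin k, ∃ o : Set E, o.Finite ∧ ∀ u ∈ S, c u = i → ∃ y ∈ o, dist (F u) y < ε := by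
    intro i
    by_cases hi : ∃ v ∈ S, c v = i
    · obtain ⟨v, hv, hvi⟩ := hi
      refine ⟨{F v}, finite_singleton _, fun u hu hui => ⟨F v, rfl, ?_⟩⟩
      have := hc u hu v hv (hui.trans hvi.symm)
      linarith
    · exact ⟨∅, finite_empty, fun u hu hui => absurd ⟨u, hu, hui⟩ hi⟩
  choose o hof ho using hex
  refine ⟨⋃ i, o i, finite_iUnion hof, ?_⟩
  rintro _ ⟨u, hu, rfl⟩
  obtain ⟨y, hy, hyd⟩ := ho (c u) u hu rfl
  exact mem_iUnion₂.mpr ⟨y, mem_iUnion.mpr ⟨_, hy⟩, hyd⟩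

theorem FinColorable.of_bounded {G E : Type*} [PseudoMetricSpace E] [ProperSpace E] {S : Set G}
    {F : G → E} (h : Bornology.IsBounded (F '' S)) :
    FinColorable S (fun u v => dist (F u) (F v)) :=
  .of_totallyBounded (h.isCompact_closure.totallyBounded.subset subset_closure)

/-! ### Invariant means along the tube -/

/-- Boundedness of a real-valued function. -/
def BddFun {ι : Type*} (a : ι → ℝ) : Prop := ∃ C, ∀ i, |a i| ≤ C

theorem BddFun.add {ι : Type*} {a b : ι → ℝ} (ha : BddFun a) (hb : BddFun b) :
    BddFun (fun i => a i + b i) := by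
  obtain ⟨C, hC⟩ := ha
  obtain ⟨D, hD⟩ := hb
  exact ⟨C + D, fun i => (abs_add_le _ _).trans (add_le_add (hC i) (hD i))⟩

theorem BddFun.const_mul {ι : Type*} {a : ι → ℝ} (ha : BddFun a) (c : ℝ) :
    BddFun (fun i => c * a i) := by
  obtain ⟨C, hC⟩ := ha
  exact ⟨|c| * C, fun i => by
    rw [abs_mul]
    exact mul_le_mul_of_nonneg_left (hC i) (abs_nonneg c)⟩

theorem BddFun.mul {ι : Type*} {a b : ι → ℝ} (ha : BddFun a) (hb : BddFun b) :
    BddFun (fun i => a i * b i) := by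
  obtain ⟨C, hC⟩ := ha
  obtain ⟨D, hD⟩ := hb
  exact ⟨C * D, fun i => by
    rw [abs_mul]
    exact mul_le_mul (hC i) (hD i) (abs_nonneg _) ((abs_nonneg _).trans (hC i))⟩

theorem BddFun.const {ι : Type*} (c : ℝ) : BddFun (fun _ : ι => c) := ⟨|c|, fun _ => le_rfl⟩

theorem BddFun.abs {ι : Type*} {a : ι → ℝ} (ha : BddFun a) : BddFun (fun i => |a i|) := by
  obtain ⟨C, hC⟩ := ha
  exact ⟨C, fun i => by rw [abs_abs]; exact hC i⟩

theorem BddFun.comp {ι κ : Type*} {a : ι → ℝ} (ha : BddFun a) (f : κ → ι) :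
    BddFun (fun i => a (f i)) := by
  obtain ⟨C, hC⟩ := ha
  exact ⟨C, fun i => hC _⟩

theorem BddFun.sum {ι κ : Type*} {a : κ → ι → ℝ} (s : Finset κ) (ha : ∀ k ∈ s, BddFun (a k)) :
    BddFun (fun i => ∑ k ∈ s, a k i) := by
  classical
  induction s using Finset.induction_on with
  | empty => simpa using BddFun.const (0 : ℝ)
  | insert k s hk ih =>
    simp only [Finset.sum_insert hk]
    exact (ha k (Finset.mem_insert_self _ _)).add
      (ih fun j hj => ha j (Finset.mem_insert_of_mem hj))

/-- A positive linear functional on bounded functions. -/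
structure PosFunctional (ι : Type*) where
  /-- the underlying function -/
  M : (ι → ℝ) → ℝ
  add' : ∀ a b, BddFun a → BddFun b → M (fun i => a i + b i) = M a + M b
  smul' : ∀ c a, BddFun a → M (fun i => c * a i) = c * M a
  mono' : ∀ a b, BddFun a → BddFun b → (∀ i, a i ≤ b i) → M a ≤ M b

namespace PosFunctional

variable {ι : Type*} (L : PosFunctional ι)

theorem map_zero : L.M (fun _ => 0) = 0 := by
  simpa using L.smul' 0 (fun _ => 0) (.const 0)

theorem map_const (c : ℝ) : L.M (fun _ => c) = c * L.M (fun _ => 1) := by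
  simpa using L.smul' c (fun _ => 1) (.const 1)

theorem nonneg {a : ι → ℝ} (ha : BddFun a) (h : ∀ i, 0 ≤ a i) : 0 ≤ L.M a := by
  rw [← L.map_zero]
  exact L.mono' _ _ (.const 0) ha h

theorem abs_le {a b : ι → ℝ} (ha : BddFun a) (hb : BddFun b) (h : ∀ i, |a i| ≤ b i) :
    |L.M a| ≤ L.M b := by
  rw [_root_.abs_le]
  refine ⟨?_, L.mono' _ _ ha hb fun i => (le_abs_self _).trans (h i)⟩
  have h1 := L.mono' (fun i => (-1) * b i) a (hb.const_mul _) ha fun i => by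
    have := neg_abs_le (a i)
    have := h i
    linarith
  rw [L.smul' _ _ hb] at h1
  linarith

theorem map_sum {κ : Type*} (s : Finset κ) {a : κ → ι → ℝ} (ha : ∀ k ∈ s, BddFun (a k)) :
    L.M (fun i => ∑ k ∈ s, a k i) = ∑ k ∈ s, L.M (a k) := by
  classical
  induction s using Finset.induction_on with
  | empty => simpa using L.map_zero
  | insert k s hk ih =>
    simp only [Finset.sum_insert hk]
    rw [← ih fun j hj => ha j (Finset.mem_insert_of_mem hj)]
    exact L.add' _ _ (ha k (Finset.mem_insert_self _ _))
      (.sum s fun j hj => ha j (Finset.mem_insert_of_mem hj))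

end PosFunctional

/-- Cesàro averages of a two-sided sequence along the nonnegative integers. -/
noncomputable def cesaro (a : ℤ → ℝ) (n : ℕ) : ℝ :=
  (∑ m ∈ Finset.range (n + 1), a m) / ((n : ℝ) + 1)

theorem abs_cesaro_le {a : ℤ → ℝ} {C : ℝ} (h : ∀ m, |a m| ≤ C) (n : ℕ) : |cesaro a n| ≤ C := by
  unfold cesaro
  rw [abs_div, abs_of_pos (show (0 : ℝ) < n + 1 by positivity), div_le_iff₀ (by positivity)]
  calc |∑ m ∈ Finset.range (n + 1), a m| ≤ ∑ m ∈ Finset.range (n + 1), |a m| :=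
        Finset.abs_sum_le_sum_abs _ _
    _ ≤ ∑ _m ∈ Finset.range (n + 1), C := Finset.sum_le_sum fun m _ => h m
    _ = C * (n + 1) := by simp; ring

/-- Banach limit of the Cesàro averages. -/
noncomputable def banachMean (a : ℤ → ℝ) : ℝ :=
  limUnder (hyperfilter ℕ : Filter ℕ) (cesaro a)

theorem tendsto_banachMean {a : ℤ → ℝ} (ha : BddFun a) :
    Tendsto (cesaro a) (hyperfilter ℕ) (𝓝 (banachMean a)) := by
  obtain ⟨C, hC⟩ := ha
  have hmem : ∀ n, cesaro a n ∈ Icc (-C) C := fun n => _root_.abs_le.mp (abs_cesaro_le hC n)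
  obtain ⟨x, -, hx⟩ := (isCompact_Icc (a := -C) (b := C)).ultrafilter_le_nhds
    ((hyperfilter ℕ).map (cesaro a)) (by
      rw [Filter.le_principal_iff]
      exact Filter.mem_map.mpr (Filter.univ_mem' hmem))
  exact tendsto_nhds_limUnder ⟨x, hx⟩

theorem hyperfilter_nat_le_atTop : (hyperfilter ℕ : Filter ℕ) ≤ atTop := by
  rw [← Nat.cofinite_eq_atTop]
  exact hyperfilter_le_cofinite

theorem banachMean_eq_zero_of_sum_bdd {a : ℤ → ℝ} (ha : BddFun a) {C : ℝ}
    (h : ∀ n : ℕ, |∑ m ∈ Finset.range (n + 1), a m| ≤ C) : banachMean a = 0 := by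
  refine tendsto_nhds_unique (tendsto_banachMean ha) (Tendsto.mono_left ?_ hyperfilter_nat_le_atTop)
  refine squeeze_zero_norm (a := fun n : ℕ => C * (1 / ((n : ℝ) + 1))) (fun n => ?_) ?_
  · rw [Real.norm_eq_abs, cesaro, abs_div, abs_of_pos (show (0 : ℝ) < n + 1 by positivity),
      mul_one_div]
    exact div_le_div_of_nonneg_right (h n) (by positivity)
  · simpa using tendsto_one_div_add_atTop_nhds_zero_nat.const_mul C

/-- The Banach mean as a positive functional on bounded functions on `ℤ`. -/
noncomputable def banachFunctional : PosFunctional ℤ where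
  M := banachMean
  add' a b ha hb := by
    refine tendsto_nhds_unique (tendsto_banachMean (ha.add hb)) ?_
    refine ((tendsto_banachMean ha).add (tendsto_banachMean hb)).congr fun n => ?_
    simp [cesaro, Finset.sum_add_distrib, add_div]
  smul' c a ha := by
    refine tendsto_nhds_unique (tendsto_banachMean (ha.const_mul c)) ?_
    refine ((tendsto_banachMean ha).const_mul c).congr fun n => ?_
    simp only [cesaro, ← Finset.mul_sum, mul_div_assoc]
  mono' a b ha hb h := by
    refine le_of_tendsto_of_tendsto' (tendsto_banachMean ha) (tendsto_banachMean hb) fun n => ?_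
    unfold cesaro
    gcongr
    exact h _

theorem banachMean_one : banachMean (fun _ => 1) = 1 := by
  refine tendsto_nhds_unique (tendsto_banachMean (.const 1)) ?_
  refine tendsto_const_nhds.congr fun n => ?_
  simp only [cesaro, Finset.sum_const, Finset.card_range, nsmul_eq_mul, mul_one]
  push_cast
  field_simp

theorem banachMean_shift_one {a : ℤ → ℝ} (ha : BddFun a) :
    banachMean (fun m => a (m + 1)) = banachMean a := by
  have h0 : banachMean (fun m => a (m + 1) + (-1) * a m) = 0 := by
    obtain ⟨C, hC⟩ := ha
    refine banachMean_eq_zero_of_sum_bdd (C := C + C)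
      ((BddFun.comp ⟨C, hC⟩ _).add (BddFun.const_mul ⟨C, hC⟩ _)) fun n => ?_
    have : ∑ m ∈ Finset.range (n + 1), (a ((m : ℤ) + 1) + (-1) * a m) = a ((n : ℤ) + 1) - a 0 := by
      have := Finset.sum_range_sub (fun m : ℕ => a (m : ℤ)) (n + 1)
      push_cast at this
      rw [← this]
      exact Finset.sum_congr rfl fun m _ => by ring
    rw [this]
    exact (abs_sub _ _).trans (add_le_add (hC _) (hC _))
  have h1 := banachFunctional.add' _ _ (ha.comp (fun m => m + 1)) (ha.const_mul (-1))
  have h2 := banachFunctional.smul' (-1) a ha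
  change banachMean _ = banachMean _ + banachMean _ at h1
  change banachMean _ = -1 * banachMean _ at h2
  rw [h0, h2] at h1
  linarith

theorem banachMean_shift {a : ℤ → ℝ} (ha : BddFun a) (k : ℤ) :
    banachMean (fun m => a (m + k)) = banachMean a := by
  induction k using Int.induction_on with
  | zero => simp
  | succ k ih =>
    rw [← ih, ← banachMean_shift_one (ha.comp fun m => m + (k : ℤ))]
    congr 1
    funext m
    congr 1
    ring
  | pred k ih =>
    rw [← ih, ← banachMean_shift_one (ha.comp fun m => m + (-(k : ℤ) - 1))]
    congr 1
    funext m
    congr 1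
    ring

/-! ### The tube and its invariant mean -/

section Tube

variable {q : ℕ} [NeZero q]

/-- The deviation of a lattice point from the line spanned by `β`. -/
def dev (β : Fin q → ℝ) (w : Fin q → ℤ) : Fin q → ℝ := fun i => (w i : ℝ) - β i * (w 0 : ℝ)

theorem dev_sub (β : Fin q → ℝ) (u v : Fin q → ℤ) : dev β (u - v) = dev β u - dev β v := by
  funext i
  simp only [dev, Pi.sub_apply, Int.cast_sub]
  ring

theorem dev_add (β : Fin q → ℝ) (u v : Fin q → ℤ) : dev β (u + v) = dev β u + dev β v := by
  funext i
  simp only [dev, Pi.add_apply, Int.cast_add]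
  ring

theorem norm_dev_le_iff (β : Fin q → ℝ) (w : Fin q → ℤ) {R : ℝ} (hR : 0 ≤ R) :
    ‖dev β w‖ ≤ R ↔ ∀ i, β i * (w 0 : ℝ) - R ≤ w i ∧ (w i : ℝ) ≤ β i * (w 0 : ℝ) + R := by
  rw [pi_norm_le_iff_of_nonneg hR]
  refine forall_congr' fun i => ?_
  rw [Real.norm_eq_abs, _root_.abs_le, dev]
  constructor <;> rintro ⟨h1, h2⟩ <;> constructor <;> linarith

/-- The lattice points of the tube of radius `2` with first coordinate `m`. -/
noncomputable def fib (β : Fin q → ℝ) (m : ℤ) : Finset (Fin q → ℤ) :=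
  (Fintype.piFinset fun i => Finset.Icc ⌈β i * m - 2⌉ ⌊β i * m + 2⌋).filter fun w => w 0 = m

theorem mem_fib {β : Fin q → ℝ} {m : ℤ} {w : Fin q → ℤ} :
    w ∈ fib β m ↔ ‖dev β w‖ ≤ 2 ∧ w 0 = m := by
  simp only [fib, Finset.mem_filter, Fintype.mem_piFinset, Finset.mem_Icc, Int.ceil_le,
    Int.le_floor, norm_dev_le_iff β w zero_le_two]
  constructor
  · rintro ⟨h, rfl⟩
    exact ⟨h, rfl⟩
  · rintro ⟨h, rfl⟩
    exact ⟨h, rfl⟩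

theorem card_fib_le (β : Fin q → ℝ) (m : ℤ) : (fib β m).card ≤ 5 ^ q := by
  refine (Finset.card_filter_le _ _).trans ?_
  rw [Fintype.card_piFinset]
  calc ∏ i, (Finset.Icc ⌈β i * m - 2⌉ ⌊β i * m + 2⌋).card ≤ ∏ _i : Fin q, 5 := by
        refine Finset.prod_le_prod' fun i _ => ?_
        rw [Int.card_Icc, Int.toNat_le]
        have h1 := Int.le_ceil (β i * m - 2)
        have h2 := Int.floor_le (β i * m + 2)
        have h3 : ((⌊β i * m + 2⌋ + 1 - ⌈β i * m - 2⌉ : ℤ) : ℝ) ≤ ((5 : ℤ) : ℝ) := by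
          push_cast
          linarith
        exact_mod_cast h3
    _ = 5 ^ q := by simp

theorem abs_sum_fib_le (β : Fin q → ℝ) {φ : (Fin q → ℤ) → ℝ} {C : ℝ} (hC : ∀ w, |φ w| ≤ C)
    (m : ℤ) : |∑ w ∈ fib β m, φ w| ≤ 5 ^ q * C := by
  have hC0 : 0 ≤ C := (abs_nonneg _).trans (hC 0)
  calc |∑ w ∈ fib β m, φ w| ≤ ∑ w ∈ fib β m, |φ w| := Finset.abs_sum_le_sum_abs _ _
    _ ≤ ∑ _w ∈ fib β m, C := Finset.sum_le_sum fun w _ => hC w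
    _ = (fib β m).card * C := by simp
    _ ≤ 5 ^ q * C := by
      gcongr
      exact_mod_cast card_fib_le β m

theorem bddFun_sum_fib (β : Fin q → ℝ) {φ : (Fin q → ℤ) → ℝ} (hφ : BddFun φ) :
    BddFun fun m => ∑ w ∈ fib β m, φ w := by
  obtain ⟨C, hC⟩ := hφ
  exact ⟨_, abs_sum_fib_le β hC⟩

/-- The mean of a bounded function over the tube of radius `2`. -/
noncomputable def tubeMean (β : Fin q → ℝ) : PosFunctional (Fin q → ℤ) where
  M φ := banachMean fun m => ∑ w ∈ fib β m, φ w
  add' a b ha hb := by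
    simp only [Finset.sum_add_distrib]
    exact banachFunctional.add' _ _ (bddFun_sum_fib β ha) (bddFun_sum_fib β hb)
  smul' c a ha := by
    simp only [← Finset.mul_sum]
    exact banachFunctional.smul' _ _ (bddFun_sum_fib β ha)
  mono' a b ha hb h :=
    banachFunctional.mono' _ _ (bddFun_sum_fib β ha) (bddFun_sum_fib β hb) fun m =>
      Finset.sum_le_sum fun w _ => h w

theorem tubeMean_translate (β : Fin q → ℝ) {φ : (Fin q → ℤ) → ℝ} (hφ : BddFun φ)
    (hsupp : ∀ w, φ w ≠ 0 → ‖dev β w‖ ≤ 1) {u : Fin q → ℤ} (hu : ‖dev β u‖ ≤ 1) :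
    (tubeMean β).M (fun w => φ (w - u)) = (tubeMean β).M φ := by
  change banachMean _ = banachMean _
  rw [← banachMean_shift (bddFun_sum_fib β hφ) (-u 0)]
  congr 1
  funext m
  refine Finset.sum_bij_ne_zero (fun w _ _ => w - u) (fun w hw h => ?_)
    (fun w _ _ w' _ _ h => sub_left_injective h) (fun w hw h => ⟨w + u, ?_, ?_, ?_⟩)
    (fun w _ _ => rfl)
  · rw [mem_fib] at hw ⊢
    refine ⟨(hsupp _ h).trans one_le_two, ?_⟩
    rw [Pi.sub_apply, hw.2, sub_eq_add_neg]
  · rw [mem_fib] at hw ⊢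
    refine ⟨?_, ?_⟩
    · rw [dev_add]
      refine (norm_add_le _ _).trans ?_
      have := hsupp _ h
      linarith
    · rw [Pi.add_apply, hw.2]
      ring
  · simpa using h
  · simp

theorem tubeMean_eq_zero (β : Fin q → ℝ) {φ : (Fin q → ℤ) → ℝ} (hφ : BddFun φ) (N : ℤ)
    (h : ∀ w, N < w 0 → φ w = 0) : (tubeMean β).M φ = 0 := by
  obtain ⟨C, hC⟩ := hφ
  have hz : ∀ m, N < m → ∑ w ∈ fib β m, φ w = 0 := fun m hm =>
    Finset.sum_eq_zero fun w hw => h w (by rw [(mem_fib.mp hw).2]; exact hm)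
  have hC0 : 0 ≤ 5 ^ q * C := (abs_nonneg _).trans (abs_sum_fib_le β hC 0)
  refine banachMean_eq_zero_of_sum_bdd (bddFun_sum_fib β ⟨C, hC⟩)
    (C := (N.toNat + 1 : ℕ) * (5 ^ q * C)) fun n => ?_
  calc |∑ m ∈ Finset.range (n + 1), ∑ w ∈ fib β m, φ w|
      ≤ ∑ m ∈ Finset.range (n + 1), |∑ w ∈ fib β m, φ w| := Finset.abs_sum_le_sum_abs _ _
    _ = ∑ m ∈ (Finset.range (n + 1)).filter (fun m : ℕ => ¬ N < m), |∑ w ∈ fib β m, φ w| := by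
        rw [Finset.sum_filter]
        refine Finset.sum_congr rfl fun m _ => ?_
        split_ifs with hm
        · rw [hz m hm, abs_zero]
        · rfl
    _ ≤ ∑ m ∈ Finset.range (N.toNat + 1), |∑ w ∈ fib β m, φ w| := by
        refine Finset.sum_le_sum_of_subset_of_nonneg (fun m hm => ?_) fun _ _ _ => abs_nonneg _
        rw [Finset.mem_filter] at hm
        rw [Finset.mem_range]
        omega
    _ ≤ ∑ _m ∈ Finset.range (N.toNat + 1), 5 ^ q * C :=
        Finset.sum_le_sum fun m _ => abs_sum_fib_le β hC m
    _ = (N.toNat + 1 : ℕ) * (5 ^ q * C) := by simp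

/-- The lattice point of the tube with first coordinate `m` nearest to the line. -/
noncomputable def nearest (β : Fin q → ℝ) (m : ℤ) : Fin q → ℤ := fun i => round (β i * m)

theorem nearest_zero {β : Fin q → ℝ} (hβ : β 0 = 1) (m : ℤ) : nearest β m 0 = m := by
  simp [nearest, hβ]

theorem norm_dev_nearest_le {β : Fin q → ℝ} (hβ : β 0 = 1) (m : ℤ) :
    ‖dev β (nearest β m)‖ ≤ 1 / 2 := by
  rw [pi_norm_le_iff_of_nonneg (by norm_num)]
  intro i
  rw [dev, nearest_zero hβ, nearest, Real.norm_eq_abs, abs_sub_comm]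
  exact abs_sub_round _

theorem bddFun_indicator_one {ι : Type*} (S : Set ι) :
    BddFun (S.indicator fun _ => (1 : ℝ)) :=
  ⟨1, fun w => by
    by_cases hw : w ∈ S <;> simp [hw]⟩

theorem one_le_tubeMean_half {β : Fin q → ℝ} (hβ : β 0 = 1) :
    1 ≤ (tubeMean β).M ({w | ‖dev β w‖ ≤ 1 / 2}.indicator fun _ => 1) := by
  refine banachMean_one.ge.trans ?_
  refine banachFunctional.mono' _ _ (.const 1) (bddFun_sum_fib β (bddFun_indicator_one _))
    fun m => ?_
  have hn := norm_dev_nearest_le hβ m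
  have hmem : nearest β m ∈ fib β m :=
    mem_fib.mpr ⟨hn.trans (by norm_num), nearest_zero hβ m⟩
  refine le_trans (le_of_eq ?_) (Finset.single_le_sum
    (f := {w | ‖dev β w‖ ≤ 1 / 2}.indicator fun _ => (1 : ℝ))
    (fun w _ => Set.indicator_nonneg (fun _ _ => zero_le_one) w) hmem)
  rw [Set.indicator_of_mem (by exact hn)]

theorem finColorable_dev (β : Fin q → ℝ) (R : ℝ) :
    FinColorable {w | ‖dev β w‖ ≤ R} (fun u v => ‖dev β u - dev β v‖) := by
  have := FinColorable.of_bounded (S := {w | ‖dev β w‖ ≤ R}) (F := dev β)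
    ((Metric.isBounded_closedBall (x := 0) (r := R)).subset (by
      rintro _ ⟨w, hw, rfl⟩
      simpa using hw))
  simpa only [dist_eq_norm] using this

theorem tubeMean_pos {β : Fin q → ℝ} (hβ : β 0 = 1) {δ : ℝ} (hδ : 0 < δ) (N : ℤ) :
    0 < (tubeMean β).M ({w | ‖dev β w‖ ≤ δ ∧ N < w 0}.indicator fun _ => 1) := by
  wlog hδ1 : δ ≤ 1 generalizing δ
  · refine (this one_pos le_rfl).trans_le ((tubeMean β).mono' _ _ (bddFun_indicator_one _)
      (bddFun_indicator_one _) fun w => Set.indicator_le_indicator_of_subset ?_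
        (fun _ => zero_le_one) w)
    exact fun w hw => ⟨hw.1.trans (not_le.mp hδ1).le, hw.2⟩
  set χ : (Fin q → ℤ) → ℝ := {w | ‖dev β w‖ ≤ δ}.indicator fun _ => 1 with hχ
  have hχb : BddFun χ := bddFun_indicator_one _
  have hχ0 : ∀ w, 0 ≤ χ w := fun w => Set.indicator_nonneg (fun _ _ => zero_le_one) w
  have hχs : ∀ w, χ w ≠ 0 → ‖dev β w‖ ≤ 1 := fun w hw =>
    le_trans (Set.mem_of_indicator_ne_zero (s := {w | ‖dev β w‖ ≤ δ}) hw) hδ1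
  have hχpos : 0 < (tubeMean β).M χ := by
    obtain ⟨k, c, hc⟩ := finColorable_dev β (1 / 2) δ hδ
    have hrep : ∀ i : Fin k, ∃ u, ‖dev β u‖ ≤ 1 / 2 ∧
        ∀ w, ‖dev β w‖ ≤ 1 / 2 → c w = i → ‖dev β (w - u)‖ ≤ δ := by
      intro i
      by_cases hi : ∃ u, ‖dev β u‖ ≤ 1 / 2 ∧ c u = i
      · obtain ⟨u, hu, hui⟩ := hi
        exact ⟨u, hu, fun w hw hwi => by
          rw [dev_sub]
          exact hc w hw u hu (hwi.trans hui.symm)⟩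
      · refine ⟨nearest β 0, norm_dev_nearest_le hβ 0, fun w hw hwi => absurd ⟨w, hw, hwi⟩ hi⟩
    choose u hu hcov using hrep
    have h1 : (1 : ℝ) ≤ k * (tubeMean β).M χ := by
      calc (1 : ℝ) ≤ _ := one_le_tubeMean_half hβ
        _ ≤ (tubeMean β).M (fun w => ∑ i, χ (w - u i)) := by
            refine (tubeMean β).mono' _ _ (bddFun_indicator_one _)
              (BddFun.sum _ fun i _ => hχb.comp fun w => w - u i) fun w => ?_
            by_cases hw : ‖dev β w‖ ≤ 1 / 2
            · rw [Set.indicator_of_mem (by exact hw)]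
              refine le_trans (le_of_eq ?_) (Finset.single_le_sum (f := fun i => χ (w - u i))
                (fun i _ => hχ0 _) (Finset.mem_univ (c w)))
              rw [hχ, Set.indicator_of_mem (by exact hcov _ w hw rfl)]
            · rw [Set.indicator_of_notMem (by exact hw)]
              exact Finset.sum_nonneg fun i _ => hχ0 _
        _ = ∑ i, (tubeMean β).M (fun w => χ (w - u i)) :=
            (tubeMean β).map_sum _ fun i _ => hχb.comp fun w => w - u i
        _ = ∑ _i : Fin k, (tubeMean β).M χ := Finset.sum_congr rfl fun i _ =>
            tubeMean_translate β hχb hχs ((hu i).trans (by norm_num))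
        _ = k * (tubeMean β).M χ := by simp
    by_contra hneg
    have : (k : ℝ) * (tubeMean β).M χ ≤ 0 :=
      mul_nonpos_of_nonneg_of_nonpos (Nat.cast_nonneg k) (not_lt.mp hneg)
    linarith
  have hsplit := (tubeMean β).add'
    ({w | ‖dev β w‖ ≤ δ ∧ N < w 0}.indicator fun _ => 1)
    ({w | ‖dev β w‖ ≤ δ ∧ ¬ N < w 0}.indicator fun _ => 1)
    (bddFun_indicator_one _) (bddFun_indicator_one _)
  rw [tubeMean_eq_zero β (φ := {w | ‖dev β w‖ ≤ δ ∧ ¬ N < w 0}.indicator fun _ => 1)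
    (bddFun_indicator_one _) N (fun w hw => Set.indicator_of_notMem (by simp [hw]) _),
    add_zero] at hsplit
  rw [← hsplit]
  refine hχpos.trans_le (le_of_eq ?_)
  congr 1
  funext w
  by_cases h1 : ‖dev β w‖ ≤ δ <;> by_cases h2 : N < w 0 <;> simp [hχ, Set.indicator, h1, h2]

end Tube

/-! ### Compactness of averaged rank-one operators -/

section Hilbert

open scoped RealInnerProductSpace

variable {H : Type*} [NormedAddCommGroup H] [InnerProductSpace ℝ H]

theorem BddFun.inner {ι : Type*} {x : ι → H} {C : ℝ} (hx : ∀ w, ‖x w‖ ≤ C) (g : H) :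
    BddFun fun w => ⟪g, x w⟫ :=
  ⟨‖g‖ * C, fun w => (abs_real_inner_le_norm _ _).trans
    (mul_le_mul_of_nonneg_left (hx w) (norm_nonneg g))⟩

theorem exists_orthonormal_of_frequently_large (Q : H → ℝ) (hQ0 : Q 0 = 0)
    (hQ : ∀ (c : ℝ) g, Q (c • g) = c ^ 2 * Q g) {ε : ℝ}
    (h : ∀ V : Submodule ℝ H, FiniteDimensional ℝ V → ∃ g ∈ Vᗮ, ε * ‖g‖ ^ 2 < Q g) (n : ℕ) :
    ∃ e : Fin n → H, Orthonormal ℝ e ∧ ∀ i, ε < Q (e i) := by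
  induction n with
  | zero => exact ⟨Fin.elim0, ⟨fun i => i.elim0, fun i => i.elim0⟩, fun i => i.elim0⟩
  | succ n ih =>
    obtain ⟨e, he, heQ⟩ := ih
    obtain ⟨g, hg, hgQ⟩ := h (Submodule.span ℝ (Set.range e))
      (FiniteDimensional.span_of_finite ℝ (Set.finite_range e))
    have hg0 : g ≠ 0 := by
      rintro rfl
      simp [hQ0] at hgQ
    have hgn : 0 < ‖g‖ := norm_pos_iff.mpr hg0
    have horth : ∀ i, ⟪e i, ‖g‖⁻¹ • g⟫ = 0 := fun i => by
      rw [real_inner_smul_right,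
        (Submodule.mem_orthogonal _ _).mp hg _ (Submodule.subset_span ⟨i, rfl⟩), mul_zero]
    refine ⟨Fin.snoc e (‖g‖⁻¹ • g), ⟨fun i => ?_, fun i j hij => ?_⟩, fun i => ?_⟩
    · refine Fin.lastCases ?_ (fun i => ?_) i
      · rw [Fin.snoc_last, norm_smul, norm_inv, norm_norm, inv_mul_cancel₀ hgn.ne']
      · rw [Fin.snoc_castSucc]
        exact he.1 i
    · revert hij
      refine Fin.lastCases ?_ (fun i => ?_) i <;> refine Fin.lastCases ?_ (fun j => ?_) j
      · exact fun hij => absurd rfl hij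
      · intro _
        rw [Fin.snoc_last, Fin.snoc_castSucc, real_inner_comm]
        exact horth j
      · intro _
        rw [Fin.snoc_last, Fin.snoc_castSucc]
        exact horth i
      · intro hij
        rw [Fin.snoc_castSucc, Fin.snoc_castSucc]
        exact he.2 fun h => hij (by rw [h])
    · refine Fin.lastCases ?_ (fun i => ?_) i
      · rw [Fin.snoc_last, hQ, inv_pow, lt_inv_mul_iff₀ (by positivity), mul_comm]
        exact hgQ
      · rw [Fin.snoc_castSucc]
        exact heQ i

theorem PosFunctional.exists_finiteDimensional {ι : Type*} (L : PosFunctional ι) {x : ι → H}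
    {C : ℝ} (hx : ∀ w, ‖x w‖ ≤ C) {ε : ℝ} (hε : 0 < ε) :
    ∃ V : Submodule ℝ H, FiniteDimensional ℝ V ∧
      ∀ g ∈ Vᗮ, L.M (fun w => ⟪g, x w⟫ ^ 2) ≤ ε * ‖g‖ ^ 2 := by
  by_contra! hcon
  have hb : ∀ g, BddFun fun w => ⟪g, x w⟫ ^ 2 := fun g => by
    simpa only [sq] using (BddFun.inner hx g).mul (BddFun.inner hx g)
  have key := exists_orthonormal_of_frequently_large (fun g => L.M fun w => ⟪g, x w⟫ ^ 2)
    (by simpa using L.map_zero)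
    (fun c g => by
      simp only [real_inner_smul_left, mul_pow]
      exact L.smul' _ _ (hb g)) hcon
  obtain ⟨n, hn⟩ := exists_nat_gt (C ^ 2 * L.M (fun _ => 1) / ε)
  obtain ⟨e, he, heQ⟩ := key n
  have h1 : n * ε ≤ C ^ 2 * L.M (fun _ => 1) := by
    calc n * ε = ∑ _i : Fin n, ε := by simp
      _ ≤ ∑ i, L.M (fun w => ⟪e i, x w⟫ ^ 2) := Finset.sum_le_sum fun i _ => (heQ i).le
      _ = L.M (fun w => ∑ i, ⟪e i, x w⟫ ^ 2) := (L.map_sum _ fun i _ => hb (e i)).symm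
      _ ≤ L.M (fun _ => C ^ 2) := by
        refine L.mono' _ _ (BddFun.sum _ fun i _ => hb (e i)) (.const _) fun w => ?_
        have := he.sum_inner_products_le (x w) (s := Finset.univ)
        simp only [Real.norm_eq_abs, sq_abs] at this
        exact this.trans (pow_le_pow_left₀ (norm_nonneg _) (hx w) 2)
      _ = C ^ 2 * L.M (fun _ => 1) := L.map_const _
  rw [div_lt_iff₀ hε] at hn
  linarith

theorem PosFunctional.abs_le_add_sq {ι : Type*} (L : PosFunctional ι) {a : ι → ℝ}
    (ha : BddFun a) {t : ℝ} (ht : 0 < t) :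
    L.M (fun w => |a w|) ≤ t * L.M (fun _ => 1) + t⁻¹ * L.M (fun w => a w ^ 2) := by
  have hsq : BddFun fun w => a w ^ 2 := by simpa only [sq] using ha.mul ha
  rw [← L.map_const, ← L.smul' _ _ hsq, ← L.add' _ _ (.const _) (hsq.const_mul _)]
  refine L.mono' _ _ ha.abs ((BddFun.const _).add (hsq.const_mul _)) fun w => ?_
  rw [← sq_abs (a w), ← mul_le_mul_iff_right₀ ht, mul_add, mul_inv_cancel_left₀ ht.ne']
  nlinarith [sq_nonneg (|a w| - t), abs_nonneg (a w)]

theorem PosFunctional.finColorable_inner {ι G : Type*} (L : PosFunctional ι) {x : ι → H} {C : ℝ}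
    (hx : ∀ w, ‖x w‖ ≤ C) {S : Set G} {F : G → H} {D : ℝ} (hF : ∀ u ∈ S, ‖F u‖ ≤ D) :
    FinColorable S (fun u v => L.M fun w => |⟪F u - F v, x w⟫|) := by
  refine .of_approx fun ε hε => ?_
  have hm : 0 ≤ L.M (fun _ => 1) := L.nonneg (.const 1) fun _ => zero_le_one
  set m := L.M (fun _ => 1) with hmdef
  set t := ε / (2 * (m + 1)) with ht
  have htpos : 0 < t := by positivity
  set η := t * (ε / 2) / ((2 * D) ^ 2 + 1) with hη
  have hηpos : 0 < η := by positivity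
  obtain ⟨V, hV, hsmall⟩ := L.exists_finiteDimensional hx hηpos
  refine ⟨fun u v => (|C| * m) * dist (V.orthogonalProjectionOnto (F u))
    (V.orthogonalProjectionOnto (F v)), ?_, fun u hu v hv => ?_⟩
  · refine FinColorable.const_mul (.of_bounded ?_) (by positivity)
    refine (Metric.isBounded_closedBall (x := 0) (r := D)).subset ?_
    rintro _ ⟨u, hu, rfl⟩
    rw [mem_closedBall_zero_iff]
    exact (V.norm_orthogonalProjectionOnto_apply_le _).trans (hF u hu)
  · set y := F u - F v with hy
    have hyn : ‖y‖ ≤ 2 * D := by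
      have h1 := hF u hu
      have h2 := hF v hv
      have h3 := norm_sub_le (F u) (F v)
      linarith
    set p : H := (V.orthogonalProjectionOnto y : H) with hp
    have hperp : y - p ∈ Vᗮ := V.sub_starProjection_mem_orthogonal y
    have hynorm : ‖y - p‖ ≤ ‖y‖ := by
      have h0 : ⟪p, y - p⟫ = 0 := (Submodule.mem_orthogonal _ _).mp hperp _ (Subtype.coe_prop _)
      have h1 := norm_add_sq_eq_norm_sq_add_norm_sq_real h0
      rw [add_sub_cancel] at h1
      nlinarith [norm_nonneg p, norm_nonneg y, norm_nonneg (y - p)]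
    have hb1 := BddFun.inner hx p
    have hb2 := BddFun.inner hx (y - p)
    have hpn : ‖p‖ = dist (V.orthogonalProjectionOnto (F u)) (V.orthogonalProjectionOnto (F v)) := by
      rw [dist_eq_norm, ← map_sub, hp, hy]
      rfl
    calc L.M (fun w => |⟪y, x w⟫|)
        ≤ L.M (fun w => |⟪p, x w⟫| + |⟪y - p, x w⟫|) := by
          refine L.mono' _ _ (BddFun.inner hx y).abs (hb1.abs.add hb2.abs) fun w => ?_
          rw [inner_sub_left y p]
          have := abs_add_le ⟪p, x w⟫ (⟪y, x w⟫ - ⟪p, x w⟫)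
          rwa [add_sub_cancel] at this
      _ = L.M (fun w => |⟪p, x w⟫|) + L.M (fun w => |⟪y - p, x w⟫|) :=
          L.add' _ _ hb1.abs hb2.abs
      _ ≤ (|C| * m) * ‖p‖ + ε := by
          refine add_le_add ?_ ?_
          · calc L.M (fun w => |⟪p, x w⟫|) ≤ L.M (fun _ => ‖p‖ * |C|) :=
                L.mono' _ _ hb1.abs (.const _) fun w => (abs_real_inner_le_norm _ _).trans
                  (mul_le_mul_of_nonneg_left ((hx w).trans (le_abs_self C)) (norm_nonneg p))
              _ = (|C| * m) * ‖p‖ := by rw [L.map_const]; ring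
          · refine (L.abs_le_add_sq hb2 htpos).trans ?_
            have h1 : t * m ≤ ε / 2 := by
              rw [ht, div_mul_eq_mul_div, div_le_iff₀ (by positivity)]
              nlinarith
            have h2 : L.M (fun w => ⟪y - p, x w⟫ ^ 2) ≤ t * (ε / 2) := by
              refine (hsmall _ hperp).trans ?_
              rw [hη, div_mul_eq_mul_div, div_le_iff₀ (by positivity)]
              have : ‖y - p‖ ^ 2 ≤ (2 * D) ^ 2 :=
                pow_le_pow_left₀ (norm_nonneg _) (hynorm.trans hyn) 2
              have : 0 < t * (ε / 2) := by positivity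
              nlinarith
            have h3 : t⁻¹ * L.M (fun w => ⟪y - p, x w⟫ ^ 2) ≤ ε / 2 := by
              rw [inv_mul_le_iff₀ htpos]
              exact h2
            linarith
      _ = _ := by rw [hpn]

end Hilbert

/-! ### Weak mixing relative to the almost periodic vectors -/

section WeakMixing

open scoped RealInnerProductSpace

variable {q : ℕ} [NeZero q] {H : Type*} [NormedAddCommGroup H] [InnerProductSpace ℝ H]

/-- A vector whose orbit along the tube of radius `1/2` is totally bounded. -/
def AlmostPeriodic (β : Fin q → ℝ) (U : (Fin q → ℤ) → H →ₗᵢ[ℝ] H) (h : H) : Prop :=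
  FinColorable {w | ‖dev β w‖ ≤ 1 / 2} (fun u v => ‖U u h - U v h‖)

/-- A Lipschitz bump function supported in the ball of radius `δ`. -/
noncomputable def bump (δ : ℝ) (t : Fin q → ℝ) : ℝ := max (1 - ‖t‖ / δ) 0

theorem bump_nonneg (δ : ℝ) (t : Fin q → ℝ) : 0 ≤ bump δ t := le_max_right _ _

theorem bump_le_one {δ : ℝ} (hδ : 0 < δ) (t : Fin q → ℝ) : bump δ t ≤ 1 :=
  max_le (sub_le_self _ (by positivity)) zero_le_one

theorem norm_le_of_bump_ne_zero {δ : ℝ} (hδ : 0 < δ) {t : Fin q → ℝ} (h : bump δ t ≠ 0) :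
    ‖t‖ ≤ δ := by
  by_contra! hlt
  refine h (max_eq_right ?_)
  rw [sub_nonpos, le_div_iff₀ hδ]
  linarith

theorem half_le_bump {δ : ℝ} (hδ : 0 < δ) {t : Fin q → ℝ} (h : ‖t‖ ≤ δ / 2) :
    1 / 2 ≤ bump δ t := by
  refine le_max_of_le_left ?_
  have : ‖t‖ / δ ≤ 1 / 2 := by
    rw [div_le_iff₀ hδ]
    linarith
  linarith

theorem abs_bump_sub_le {δ : ℝ} (hδ : 0 < δ) (s t : Fin q → ℝ) :
    |bump δ s - bump δ t| ≤ ‖s - t‖ / δ := by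
  refine (abs_max_sub_max_le_abs _ _ _).trans ?_
  rw [show 1 - ‖s‖ / δ - (1 - ‖t‖ / δ) = -((‖s‖ - ‖t‖) / δ) by ring, abs_neg, abs_div,
    abs_of_pos hδ]
  exact div_le_div_of_nonneg_right (abs_norm_sub_norm_le s t) hδ.le

theorem bddFun_bump {ι : Type*} {δ : ℝ} (hδ : 0 < δ) (t : ι → Fin q → ℝ) :
    BddFun fun w => bump δ (t w) :=
  ⟨1, fun w => by
    rw [abs_of_nonneg (bump_nonneg _ _)]
    exact bump_le_one hδ _⟩

variable {β : Fin q → ℝ} {U : (Fin q → ℤ) → H →ₗᵢ[ℝ] H}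

theorem inner_rep_left (hU0 : ∀ x, U 0 x = x) (hU : ∀ u v x, U (u + v) x = U u (U v x))
    (u : Fin q → ℤ) (x y : H) : ⟪U u x, y⟫ = ⟪x, U (-u) y⟫ := by
  rw [← (U u).inner_map_map x (U (-u) y), ← hU, add_neg_cancel, hU0]

theorem AlmostPeriodic.rep (hU : ∀ u v x, U (u + v) x = U u (U v x)) {h : H}
    (hh : AlmostPeriodic β U h) (w : Fin q → ℤ) : AlmostPeriodic β U (U w h) := by
  refine hh.mono le_rfl fun u _ v _ => le_of_eq ?_
  rw [← hU, ← hU, add_comm u, add_comm v, hU, hU, ← map_sub, LinearIsometry.norm_map]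

/-- The tube-averaged bilinear form of the rank-one operators `⟪·, U w f⟫ U w f`. -/
noncomputable def avgForm (β : Fin q → ℝ) (U : (Fin q → ℤ) → H →ₗᵢ[ℝ] H) (δ : ℝ) (f g h : H) : ℝ :=
  (tubeMean β).M fun w => (bump δ (dev β w) * ⟪g, U w f⟫) * ⟪h, U w f⟫

theorem bddFun_inner_rep (U : (Fin q → ℤ) → H →ₗᵢ[ℝ] H) (f g : H) :
    BddFun fun w => ⟪g, U w f⟫ :=
  BddFun.inner (fun w => (LinearIsometry.norm_map (U w) f).le) g

theorem exists_avg_vector [CompleteSpace H] {δ : ℝ} (hδ : 0 < δ) (f g : H) :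
    ∃ k : H, ∀ h, ⟪k, h⟫ = avgForm β U δ f g h := by
  have hb : BddFun fun w => bump δ (dev β w) * ⟪g, U w f⟫ :=
    (bddFun_bump hδ _).mul (bddFun_inner_rep U f g)
  obtain ⟨C, hC⟩ := hb
  let ℓ : H →ₗ[ℝ] ℝ :=
    { toFun := avgForm β U δ f g
      map_add' := fun x y => by
        simp only [avgForm, inner_add_left, mul_add]
        exact (tubeMean β).add' _ _ (BddFun.mul ⟨C, hC⟩ (bddFun_inner_rep U f x))
          (BddFun.mul ⟨C, hC⟩ (bddFun_inner_rep U f y))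
      map_smul' := fun c x => by
        simp only [avgForm, real_inner_smul_left, mul_left_comm _ c]
        exact (tubeMean β).smul' _ _ (BddFun.mul ⟨C, hC⟩ (bddFun_inner_rep U f x)) }
  have hℓ : ∀ h, ‖ℓ h‖ ≤ (C * ‖f‖ * (tubeMean β).M fun _ => 1) * ‖h‖ := fun h => by
    have h1 := (tubeMean β).abs_le (BddFun.mul ⟨C, hC⟩ (bddFun_inner_rep U f h))
      (.const (C * (‖h‖ * ‖f‖))) fun w => by
        rw [abs_mul]
        refine mul_le_mul (hC w) ?_ (abs_nonneg _) ((abs_nonneg _).trans (hC w))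
        simpa using abs_real_inner_le_norm h (U w f)
    rw [(tubeMean β).map_const] at h1
    exact h1.trans (le_of_eq (by ring))
  refine ⟨(InnerProductSpace.toDual ℝ H).symm (ℓ.mkContinuous _ hℓ), fun h => ?_⟩
  rw [InnerProductSpace.toDual_symm_apply]
  rfl

theorem avgForm_translate (hU0 : ∀ x, U 0 x = x) (hU : ∀ u v x, U (u + v) x = U u (U v x))
    {δ : ℝ} (hδ : 0 < δ) (hδ1 : δ ≤ 1 / 2) (f g h : H) {u : Fin q → ℤ}
    (hu : ‖dev β u‖ ≤ 1 / 2) :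
    avgForm β U δ f g (U (-u) h) =
      (tubeMean β).M fun w => (bump δ (dev β w - dev β u) * ⟪U u g, U w f⟫) * ⟪h, U w f⟫ := by
  set φ : (Fin q → ℤ) → ℝ := fun w =>
    (bump δ (dev β w) * ⟪g, U w f⟫) * ⟪U (-u) h, U w f⟫ with hφ
  have hφb : BddFun φ := ((bddFun_bump hδ _).mul (bddFun_inner_rep U f g)).mul
    (bddFun_inner_rep U f _)
  have := tubeMean_translate β hφb (fun w hw => ?_) (hu.trans (by norm_num))
  · rw [avgForm, ← hφ, ← this]
    congr 1
    funext w
    have h1 : U (w - u) f = U (-u) (U w f) := by rw [← hU, sub_eq_neg_add]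
    rw [hφ]
    simp only
    rw [dev_sub, h1, (U (-u)).inner_map_map, inner_rep_left hU0 hU]
  · have hw' : bump δ (dev β w) ≠ 0 := fun h0 => hw (by simp [hφ, h0])
    exact (norm_le_of_bump_ne_zero hδ hw').trans (hδ1.trans (by norm_num))

theorem almostPeriodic_avg_vector (hU0 : ∀ x, U 0 x = x)
    (hU : ∀ u v x, U (u + v) x = U u (U v x)) {δ : ℝ} (hδ : 0 < δ) (hδ1 : δ ≤ 1 / 2) (f g : H)
    {k : H} (hk : ∀ h, ⟪k, h⟫ = avgForm β U δ f g h) : AlmostPeriodic β U k := by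
  set m := (tubeMean β).M (fun _ => 1) with hm
  have hm0 : 0 ≤ m := (tubeMean β).nonneg (.const 1) fun _ => zero_le_one
  have hcol : FinColorable {w | ‖dev β w‖ ≤ 1 / 2} (fun u v =>
      ‖f‖ * ((‖g‖ * ‖f‖ * m / δ) * ‖dev β u - dev β v‖ +
        (tubeMean β).M fun w => |⟪U u g - U v g, U w f⟫|)) :=
    (((finColorable_dev β (1 / 2)).const_mul (by positivity)).add
      ((tubeMean β).finColorable_inner (fun w => (LinearIsometry.norm_map (U w) f).le)
        (F := fun u => U u g) (D := ‖g‖) fun u _ => (LinearIsometry.norm_map (U u) g).le)).const_mul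
      (norm_nonneg f)
  refine hcol.mono le_rfl fun u hu v hv => ?_
  set E : (Fin q → ℤ) → ℝ := fun w => bump δ (dev β w - dev β u) * ⟪U u g, U w f⟫ -
    bump δ (dev β w - dev β v) * ⟪U v g, U w f⟫ with hE
  have hbu : ∀ u, BddFun fun w => bump δ (dev β w - dev β u) * ⟪U u g, U w f⟫ := fun u =>
    (bddFun_bump hδ _).mul (bddFun_inner_rep U f _)
  have hEb : BddFun E := by
    simpa [hE, sub_eq_add_neg] using (hbu u).add ((hbu v).const_mul (-1))
  have hdb := bddFun_inner_rep U f (U u g - U v g)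
  set c : ℝ := ‖dev β u - dev β v‖ / δ * (‖g‖ * ‖f‖) with hc
  have hE' : ∀ w, |E w| ≤ c + |⟪U u g - U v g, U w f⟫| := fun w => by
    have h1 : E w = (bump δ (dev β w - dev β u) - bump δ (dev β w - dev β v)) * ⟪U v g, U w f⟫ +
        bump δ (dev β w - dev β u) * ⟪U u g - U v g, U w f⟫ := by
      rw [hE, inner_sub_left]
      ring
    rw [h1]
    refine (abs_add_le _ _).trans (add_le_add ?_ ?_)
    · rw [abs_mul]
      refine mul_le_mul ?_ ?_ (abs_nonneg _) (by positivity)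
      · refine (abs_bump_sub_le hδ _ _).trans (le_of_eq ?_)
        rw [sub_sub_sub_cancel_left, norm_sub_rev]
      · simpa using abs_real_inner_le_norm (U v g) (U w f)
    · rw [abs_mul, abs_of_nonneg (bump_nonneg _ _)]
      exact mul_le_of_le_one_left (abs_nonneg _) (bump_le_one hδ _)
  have hME : (tubeMean β).M (fun w => |E w|) ≤
      c * m + (tubeMean β).M fun w => |⟪U u g - U v g, U w f⟫| := by
    rw [← (tubeMean β).map_const, ← (tubeMean β).add' _ _ (.const _) hdb.abs]
    exact (tubeMean β).mono' _ _ hEb.abs ((BddFun.const _).add hdb.abs) hE'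
  set y := U u k - U v k with hy
  have hyy : ⟪y, y⟫ = (tubeMean β).M fun w => E w * ⟪y, U w f⟫ := by
    have h1 : ⟪y, y⟫ = ⟪U u k, y⟫ + (-1) * ⟪U v k, y⟫ := by
      conv_lhs => rw [hy, inner_sub_left]
      ring
    rw [h1, inner_rep_left hU0 hU, inner_rep_left hU0 hU, hk, hk,
      avgForm_translate hU0 hU hδ hδ1 f g y hu, avgForm_translate hU0 hU hδ hδ1 f g y hv,
      ← (tubeMean β).smul' _ _ ((hbu v).mul (bddFun_inner_rep U f y)),
      ← (tubeMean β).add' _ _ ((hbu u).mul (bddFun_inner_rep U f y))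
        (((hbu v).mul (bddFun_inner_rep U f y)).const_mul _)]
    congr 1
    funext w
    rw [hE]
    ring
  have hle : ‖y‖ * ‖y‖ ≤ (‖y‖ * ‖f‖) * (tubeMean β).M (fun w => |E w|) := by
    rw [← real_inner_self_eq_norm_mul_norm, hyy, ← (tubeMean β).smul' _ _ hEb.abs]
    refine (le_abs_self _).trans ((tubeMean β).abs_le (hEb.mul (bddFun_inner_rep U f y))
      (hEb.abs.const_mul _) fun w => ?_)
    rw [abs_mul, mul_comm]
    refine mul_le_mul_of_nonneg_right ?_ (abs_nonneg _)
    simpa using abs_real_inner_le_norm y (U w f)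
  have hM0 : 0 ≤ (tubeMean β).M (fun w => |E w|) :=
    (tubeMean β).nonneg hEb.abs fun _ => abs_nonneg _
  have hfin : ‖y‖ ≤ ‖f‖ * (tubeMean β).M (fun w => |E w|) := by
    rcases (norm_nonneg y).eq_or_lt with h0 | h0
    · rw [← h0]
      positivity
    · rw [mul_assoc] at hle
      exact le_of_mul_le_mul_left hle h0
  refine hfin.trans (mul_le_mul_of_nonneg_left (hME.trans (le_of_eq ?_)) (norm_nonneg f))
  rw [hc]
  ring

theorem avgForm_self_eq_zero [CompleteSpace H] (hU0 : ∀ x, U 0 x = x)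
    (hU : ∀ u v x, U (u + v) x = U u (U v x)) {δ : ℝ} (hδ : 0 < δ) (hδ1 : δ ≤ 1 / 2) {f : H}
    (hf : ∀ h, AlmostPeriodic β U h → ⟪f, h⟫ = 0) (g : H) : avgForm β U δ f g g = 0 := by
  obtain ⟨k, hk⟩ := exists_avg_vector (β := β) (U := U) hδ f g
  have hap := almostPeriodic_avg_vector hU0 hU hδ hδ1 f g hk
  have hkk : ⟪k, k⟫ = 0 := by
    rw [hk, avgForm, ← (tubeMean β).map_zero]
    congr 1
    funext w
    rw [real_inner_comm (U w f) k, inner_rep_left hU0 hU w f k, hf _ (hap.rep hU (-w)), mul_zero]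
  rw [← hk, inner_self_eq_zero.mp hkk, inner_zero_left]

theorem exists_weakly_small [CompleteSpace H] (hβ : β 0 = 1) (hU0 : ∀ x, U 0 x = x)
    (hU : ∀ u v x, U (u + v) x = U u (U v x)) {ι : Type*} (s : Finset ι) (f g : ι → H)
    (hf : ∀ i ∈ s, ∀ h, AlmostPeriodic β U h → ⟪f i, h⟫ = 0) {ε δ : ℝ} (hε : 0 < ε) (hδ : 0 < δ)
    (N : ℤ) : ∃ w, ‖dev β w‖ ≤ δ ∧ N < w 0 ∧ ∀ i ∈ s, |⟪g i, U w (f i)⟫| < ε := by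
  by_contra! hcon
  set ρ := min δ (1 / 2) with hρ
  have hρpos : 0 < ρ := lt_min hδ (by norm_num)
  have hb : ∀ i, BddFun fun w => (bump ρ (dev β w) * ⟪g i, U w (f i)⟫) * ⟪g i, U w (f i)⟫ :=
    fun i => ((bddFun_bump hρpos _).mul (bddFun_inner_rep U _ _)).mul (bddFun_inner_rep U _ _)
  have hzero : (tubeMean β).M (fun w => ∑ i ∈ s,
      (bump ρ (dev β w) * ⟪g i, U w (f i)⟫) * ⟪g i, U w (f i)⟫) = 0 := by
    rw [(tubeMean β).map_sum _ fun i _ => hb i]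
    exact Finset.sum_eq_zero fun i hi =>
      avgForm_self_eq_zero hU0 hU hρpos (min_le_right _ _) (hf i hi) (g i)
  have hnn : ∀ w i, 0 ≤ (bump ρ (dev β w) * ⟪g i, U w (f i)⟫) * ⟪g i, U w (f i)⟫ := fun w i => by
    rw [mul_assoc]
    exact mul_nonneg (bump_nonneg _ _) (mul_self_nonneg _)
  have hlow : (ε ^ 2 / 2) *
      (tubeMean β).M ({w | ‖dev β w‖ ≤ ρ / 2 ∧ N < w 0}.indicator fun _ => 1) ≤ 0 := by
    rw [← hzero, ← (tubeMean β).smul' _ _ (bddFun_indicator_one _)]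
    refine (tubeMean β).mono' _ _ ((bddFun_indicator_one _).const_mul _)
      (BddFun.sum _ fun i _ => hb i) fun w => ?_
    by_cases hw : ‖dev β w‖ ≤ ρ / 2 ∧ N < w 0
    · rw [Set.indicator_of_mem (by exact hw), mul_one]
      obtain ⟨i, hi, hi'⟩ := hcon w (hw.1.trans ((half_le_self hρpos.le).trans (min_le_left _ _)))
        hw.2
      refine le_trans ?_ (Finset.single_le_sum (fun i _ => hnn w i) hi)
      have h1 := half_le_bump hρpos hw.1
      have h2 : ε ^ 2 ≤ ⟪g i, U w (f i)⟫ * ⟪g i, U w (f i)⟫ := by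
        rw [← abs_mul_abs_self, sq]
        exact mul_self_le_mul_self hε.le hi'
      rw [mul_assoc]
      nlinarith [sq_nonneg ε]
    · rw [Set.indicator_of_notMem (by exact hw), mul_zero]
      exact Finset.sum_nonneg fun i _ => hnn w i
  have hpos := tubeMean_pos hβ (half_pos hρpos) N
  have : 0 < ε ^ 2 / 2 := by positivity
  nlinarith

end WeakMixing

/-! ### Almost periodic sets and the directional Kronecker algebra -/

section Kronecker

variable {X : Type*} [mX : MeasurableSpace X] {q : ℕ} [NeZero q] {μ : Measure X}
  [IsProbabilityMeasure μ] {T : (Fin q → ℤ) → X → X} {β : Fin q → ℝ}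

/-- The pseudodistance `μ (T_u⁻¹ B ∆ T_v⁻¹ B)` on the acting group. -/
noncomputable def orbitDist (μ : Measure X) (T : (Fin q → ℤ) → X → X) (B : Set X)
    (u v : Fin q → ℤ) : ℝ :=
  μ.real (symmDiff (T u ⁻¹' B) (T v ⁻¹' B))

theorem LamQ_one (hβ : β 0 = 1) : LamQ β (fun _ => 1) = {w | ‖dev β w‖ ≤ 1 / 2} := by
  ext w
  simp only [LamQ, mem_ofPred_eq, norm_dev_le_iff β w (by norm_num : (0 : ℝ) ≤ 1 / 2)]
  refine ⟨fun h i => ?_, fun h i _ => h i⟩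
  by_cases hi : i = 0
  · subst hi
    rw [hβ]
    constructor <;> linarith
  · exact h i hi

theorem korbit_eq_image (hmp : ∀ w, MeasurePreserving (T w) μ μ) (Λ : Set (Fin q → ℤ)) {B : Set X}
    (hB : MeasurableSet B) : korbit μ T Λ B =
      (fun w => indicatorConstLp 2 ((hmp w).measurable hB) (measure_ne_top μ _) (1 : ℝ)) '' Λ := by
  ext g
  simp only [korbit, mem_ofPred_eq, mem_image]
  refine exists_congr fun w => and_congr_right fun _ => ?_
  have h := indicatorConstLp_coeFn (p := 2) (hs := (hmp w).measurable hB)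
    (hμs := measure_ne_top μ _) (c := (1 : ℝ))
  have h' : (T w ⁻¹' B).indicator (fun _ => (1 : ℝ)) = fun x => B.indicator (fun _ => 1) (T w x) :=
    rfl
  rw [h'] at h
  exact ⟨fun hg => Lp.ext (h.trans hg.symm), fun hg => by rw [← hg]; exact h⟩

theorem dist_indicatorConstLp_preimage (hmp : ∀ w, MeasurePreserving (T w) μ μ) {B : Set X}
    (hB : MeasurableSet B) (u v : Fin q → ℤ) :
    dist (indicatorConstLp 2 ((hmp u).measurable hB) (measure_ne_top μ _) (1 : ℝ))
      (indicatorConstLp 2 ((hmp v).measurable hB) (measure_ne_top μ _) (1 : ℝ)) ^ 2 =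
      orbitDist μ T B u v := by
  rw [dist_indicatorConstLp_eq_norm, norm_indicatorConstLp two_ne_zero ENNReal.ofNat_ne_top]
  simp only [norm_one, one_mul, ENNReal.toReal_ofNat]
  rw [← Real.sqrt_eq_rpow, Real.sq_sqrt measureReal_nonneg]
  rfl

theorem mem_dirKronQ_iff (hβ : β 0 = 1) (hmp : ∀ w, MeasurePreserving (T w) μ μ) {B : Set X} :
    B ∈ dirKronQ μ T β (fun _ => 1) ↔
      MeasurableSet B ∧ FinColorable {w | ‖dev β w‖ ≤ 1 / 2} (orbitDist μ T B) := by
  refine and_congr_right fun hB => ?_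
  rw [LamQ_one hβ, korbit_eq_image hmp _ hB]
  constructor
  · intro h
    have h1 := FinColorable.of_totallyBounded (h.totallyBounded.subset subset_closure)
    exact (h1.sq fun _ _ => dist_nonneg).mono le_rfl fun u _ v _ =>
      (dist_indicatorConstLp_preimage hmp hB u v).ge
  · intro h
    refine TotallyBounded.isCompact_of_isClosed (TotallyBounded.closure ?_) isClosed_closure
    refine FinColorable.totallyBounded (FinColorable.of_sq ?_)
    exact h.mono le_rfl fun u _ v _ => (dist_indicatorConstLp_preimage hmp hB u v).le

theorem dirKronAlgQ_le (μ : Measure X) (T : (Fin q → ℤ) → X → X) (β : Fin q → ℝ) :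
    dirKronAlgQ μ T β ≤ mX :=
  MeasurableSpace.generateFrom_le fun _ h => h.1

theorem finColorable_orbitDist (hβ : β 0 = 1) (hmp : ∀ w, MeasurePreserving (T w) μ μ) {B : Set X}
    (hB : MeasurableSet[dirKronAlgQ μ T β] B) :
    FinColorable {w | ‖dev β w‖ ≤ 1 / 2} (orbitDist μ T B) := by
  induction B, hB using MeasurableSpace.generateFrom_induction with
  | hC t ht _ => exact ((mem_dirKronQ_iff hβ hmp).mp ht).2
  | empty =>
    refine fun ε hε => ⟨1, fun _ => 0, fun u _ v _ _ => ?_⟩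
    simpa [orbitDist] using hε.le
  | compl t _ ih =>
    refine ih.mono le_rfl fun u _ v _ => le_of_eq ?_
    simp only [orbitDist, preimage_compl, compl_symmDiff_compl]
  | iUnion s hs ih =>
    have hsm : ∀ n, MeasurableSet (s n) := fun n => dirKronAlgQ_le μ T β _ (hs n)
    refine FinColorable.of_approx fun ε hε => ?_
    set V : ℕ → Set X := fun n => ⋃ k, ⋃ (_ : k ≤ n), s k with hV
    have hVm : ∀ n, MeasurableSet (V n) := fun n =>
      MeasurableSet.iUnion fun k => MeasurableSet.iUnion fun _ => hsm k
    have hmono : Monotone V := fun m n hmn =>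
      iUnion_mono fun k => iUnion_subset fun hk => subset_iUnion_of_subset (hk.trans hmn) le_rfl
    have hUV : ⋃ n, V n = ⋃ n, s n := by
      ext x
      simp only [hV, mem_iUnion]
      exact ⟨fun ⟨_, k, _, hk⟩ => ⟨k, hk⟩, fun ⟨k, hk⟩ => ⟨k, k, le_rfl, hk⟩⟩
    obtain ⟨n, hn⟩ : ∃ n, μ.real ((⋃ i, s i) \ V n) ≤ ε / 2 := by
      have h0 : Tendsto (fun n => μ.real ((⋃ i, s i) \ V n)) atTop (𝓝 0) := by
        have := tendsto_measure_iInter_atTop (μ := μ) (s := fun n => (⋃ i, s i) \ V n)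
          (fun n => ((MeasurableSet.iUnion hsm).diff (hVm n)).nullMeasurableSet)
          (fun m n hmn => sdiff_subset_sdiff_right (hmono hmn)) ⟨0, measure_ne_top _ _⟩
        rw [← sdiff_iUnion, hUV, sdiff_self, measure_empty] at this
        exact (ENNReal.tendsto_toReal ENNReal.zero_ne_top).comp this
      exact (h0.eventually (ge_mem_nhds (by positivity : (0 : ℝ) < ε / 2))).exists
    refine ⟨fun u v => ∑ i : Fin (n + 1), orbitDist μ T (s i) u v,
      FinColorable.sum fun i => ih i, fun u _ v _ => ?_⟩
    have hsub : symmDiff (T u ⁻¹' ⋃ i, s i) (T v ⁻¹' ⋃ i, s i) ⊆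
        (⋃ i : Fin (n + 1), symmDiff (T u ⁻¹' s i) (T v ⁻¹' s i)) ∪
          ((T u ⁻¹' ((⋃ i, s i) \ V n)) ∪ (T v ⁻¹' ((⋃ i, s i) \ V n))) := by
      intro x hx
      by_contra hcon
      simp only [mem_union, mem_iUnion, not_or, not_exists, mem_symmDiff, mem_preimage, Set.mem_sdiff,
        hV] at hx hcon
      obtain ⟨h1, h2, h3⟩ := hcon
      have key : ∀ {a b : X}, (∀ i : Fin (n + 1), a ∈ s i → b ∈ s i) → (∃ i, a ∈ s i) →
          (¬((∃ i, a ∈ s i) ∧ ∀ k, ¬∃ (_ : k ≤ n), a ∈ s k)) → ∃ i, b ∈ s i := by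
        intro a b hab ha h
        by_contra! hb
        exact h ⟨ha, fun k ⟨hk, hk'⟩ => hb k (hab ⟨k, Nat.lt_succ_of_le hk⟩ hk')⟩
      rcases hx with ⟨hx, hx'⟩ | ⟨hx, hx'⟩
      · obtain ⟨i, hi⟩ := key (b := T v x) (fun i hi => by
          by_contra hc
          exact (h1 i).1 ⟨hi, hc⟩) hx (by simpa using h2)
        exact hx' i hi
      · obtain ⟨i, hi⟩ := key (b := T u x) (fun i hi => by
          by_contra hc
          exact (h1 i).2 ⟨hi, hc⟩) hx (by simpa using h3)
        exact hx' i hi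
    have hpre : ∀ w, μ.real (T w ⁻¹' ((⋃ i, s i) \ V n)) ≤ ε / 2 := fun w => by
      rw [measureReal_def, (hmp w).measure_preimage
        ((MeasurableSet.iUnion hsm).diff (hVm n)).nullMeasurableSet]
      exact hn
    calc orbitDist μ T (⋃ i, s i) u v ≤ μ.real ((⋃ i : Fin (n + 1),
          symmDiff (T u ⁻¹' s i) (T v ⁻¹' s i)) ∪
          ((T u ⁻¹' ((⋃ i, s i) \ V n)) ∪ (T v ⁻¹' ((⋃ i, s i) \ V n)))) := measureReal_mono hsub
      _ ≤ μ.real (⋃ i : Fin (n + 1), symmDiff (T u ⁻¹' s i) (T v ⁻¹' s i)) +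
          (μ.real (T u ⁻¹' ((⋃ i, s i) \ V n)) + μ.real (T v ⁻¹' ((⋃ i, s i) \ V n))) :=
        (measureReal_union_le _ _).trans (add_le_add le_rfl (measureReal_union_le _ _))
      _ ≤ (∑ i : Fin (n + 1), orbitDist μ T (s i) u v) + (ε / 2 + ε / 2) :=
        add_le_add (measureReal_iUnion_fintype_le _) (add_le_add (hpre u) (hpre v))
      _ = _ := by ring

/-- Colourability over the tube of radius `1/2` passes to tubes of any radius, for a pseudodistance
invariant under translations. -/
theorem FinColorable.of_translate (hβ : β 0 = 1) {d : (Fin q → ℤ) → (Fin q → ℤ) → ℝ}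
    (h : FinColorable {w | ‖dev β w‖ ≤ 1 / 2} d)
    (hd : ∀ u v f, d (u + f) (v + f) = d u v) (R : ℝ) : FinColorable {w | ‖dev β w‖ ≤ R} d := by
  refine FinColorable.of_finite fun ε hε => ?_
  obtain ⟨k, c, hc⟩ := h ε hε
  set r : (Fin q → ℤ) → Fin q → ℤ := fun u => u - nearest β (u 0) with hr
  have hdevr : ∀ u, ‖dev β u‖ ≤ R → ‖dev β (r u)‖ ≤ R + 1 / 2 := fun u hu => by
    rw [hr, dev_sub]
    exact (norm_sub_le _ _).trans <| add_le_add hu <| norm_dev_nearest_le hβ _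
  have hr0 : ∀ u, r u 0 = 0 := fun u => by
    simp [hr, nearest_zero hβ]
  obtain ⟨k', c', hc'⟩ := FinColorable.of_bounded (S := {w | ‖dev β w‖ ≤ R})
    (F := fun u => dev β (r u)) ((Metric.isBounded_closedBall (x := 0) (r := R + 1 / 2)).subset (by
      rintro _ ⟨w, hw, rfl⟩
      simpa using hdevr w hw)) (1 / 2) (by norm_num)
  refine ⟨Fin k × Fin k', inferInstance, fun u => (c (nearest β (u 0)), c' u),
    fun u hu v hv huv => ?_⟩
  obtain ⟨h1, h2⟩ := Prod.mk.inj huv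
  have hruv : r u = r v := by
    have h3 := hc' u hu v hv h2
    simp only [dist_eq_norm] at h3
    rw [pi_norm_le_iff_of_nonneg (by norm_num)] at h3
    funext i
    have h4 := h3 i
    simp only [Pi.sub_apply, dev, hr0, Int.cast_zero, mul_zero, sub_zero, Real.norm_eq_abs] at h4
    have h5 : |r u i - r v i| < 1 := by
      have : (|r u i - r v i| : ℝ) < 1 := lt_of_le_of_lt h4 (by norm_num)
      exact_mod_cast this
    linarith [Int.abs_lt_one_iff.mp h5]
  have h6 : ∀ u, u = nearest β (u 0) + r u := fun u => by simp [hr]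
  rw [h6 u, h6 v, ← hruv, hd]
  exact hc _ (norm_dev_nearest_le hβ _) _ (norm_dev_nearest_le hβ _) h1

theorem LamQ_subset (hβ : β 0 = 1) (b : Fin q → ℝ) : ∃ R, LamQ β b ⊆ {w | ‖dev β w‖ ≤ R} := by
  refine ⟨∑ i, |b i|, fun w hw => ?_⟩
  have h0 : ∀ i, |b i| ≤ ∑ i, |b i| := fun i =>
    Finset.single_le_sum (fun i _ => abs_nonneg (b i)) (Finset.mem_univ i)
  have hR : 0 ≤ ∑ i, |b i| := Finset.sum_nonneg fun i _ => abs_nonneg _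
  rw [mem_ofPred_eq, norm_dev_le_iff _ _ hR]
  intro i
  by_cases hi : i = 0
  · subst hi
    rw [hβ]
    constructor <;> linarith
  · have h1 := hw i hi
    have h2 := h0 i
    have h3 := le_abs_self (b i)
    have h4 := abs_nonneg (b i)
    constructor <;> linarith [h1.1, h1.2]

theorem orbitDist_translate (hadd : ∀ v w, T (v + w) = T v ∘ T w)
    (hmp : ∀ w, MeasurePreserving (T w) μ μ) {B : Set X} (hB : MeasurableSet B)
    (u v f : Fin q → ℤ) : orbitDist μ T B (u + f) (v + f) = orbitDist μ T B u v := by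
  rw [orbitDist, hadd, hadd, preimage_comp, preimage_comp, ← preimage_symmDiff, measureReal_def,
    (hmp f).measure_preimage (((hmp u).measurable hB).symmDiff
      ((hmp v).measurable hB)).nullMeasurableSet]
  rfl

theorem finColorable_orbitDist_LamQ (hβ : β 0 = 1) (hadd : ∀ v w, T (v + w) = T v ∘ T w)
    (hmp : ∀ w, MeasurePreserving (T w) μ μ) {B : Set X}
    (hB : MeasurableSet[dirKronAlgQ μ T β] B) (b : Fin q → ℝ) :
    FinColorable (LamQ β b) (orbitDist μ T B) := by
  obtain ⟨R, hR⟩ := LamQ_subset hβ b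
  exact ((finColorable_orbitDist hβ hmp hB).of_translate hβ
    (orbitDist_translate hadd hmp (dirKronAlgQ_le μ T β _ hB)) R).mono hR fun _ _ _ _ => le_rfl

end Kronecker

section Koopman

open scoped RealInnerProductSpace

variable {X : Type*} [mX : MeasurableSpace X] {q : ℕ} [NeZero q] {μ : Measure X}
  [IsProbabilityMeasure μ] {T : (Fin q → ℤ) → X → X} {β : Fin q → ℝ}

/-- The Koopman representation on `L²(μ)`. -/
noncomputable def koopman (hmp : ∀ w, MeasurePreserving (T w) μ μ) (w : Fin q → ℤ) :
    Lp ℝ 2 μ →ₗᵢ[ℝ] Lp ℝ 2 μ :=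
  Lp.compMeasurePreservingₗᵢ ℝ (T w) (hmp w)

theorem coeFn_koopman (hmp : ∀ w, MeasurePreserving (T w) μ μ) (w : Fin q → ℤ) (f : Lp ℝ 2 μ) :
    koopman hmp w f =ᵐ[μ] f ∘ T w :=
  Lp.coeFn_compMeasurePreserving f (hmp w)

theorem koopman_zero (h0 : T 0 = _root_.id) (hmp : ∀ w, MeasurePreserving (T w) μ μ)
    (f : Lp ℝ 2 μ) : koopman hmp 0 f = f := by
  refine Lp.ext ((coeFn_koopman hmp 0 f).trans ?_)
  rw [h0]
  rfl

theorem koopman_add (hadd : ∀ v w, T (v + w) = T v ∘ T w)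
    (hmp : ∀ w, MeasurePreserving (T w) μ μ) (u v : Fin q → ℤ) (f : Lp ℝ 2 μ) :
    koopman hmp (u + v) f = koopman hmp u (koopman hmp v f) := by
  refine Lp.ext ((coeFn_koopman hmp _ f).trans ?_)
  refine Filter.EventuallyEq.trans ?_ (coeFn_koopman hmp u _).symm
  rw [add_comm, hadd]
  exact ((hmp u).quasiMeasurePreserving.ae_eq_comp (coeFn_koopman hmp v f)).symm

theorem integral_sq_eq_norm_sq (f : Lp ℝ 2 μ) : ∫ x, (f x) ^ 2 ∂μ = ‖f‖ ^ 2 := by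
  rw [← real_inner_self_eq_norm_sq, L2.inner_def]
  simp [sq]

theorem AlmostPeriodic.finColorable_superlevel {hmp : ∀ w, MeasurePreserving (T w) μ μ}
    {h : Lp ℝ 2 μ} (hh : AlmostPeriodic β (koopman hmp) h) {g : X → ℝ} (hg : Measurable g)
    (hgh : h =ᵐ[μ] g) (c : ℝ) :
    FinColorable {w | ‖dev β w‖ ≤ 1 / 2} (orbitDist μ T {x | c < g x}) := by
  refine FinColorable.of_approx fun ε hε => ?_
  set E : ℕ → Set X := fun n => {x | c < g x ∧ g x ≤ c + 1 / ((n : ℝ) + 1)} with hE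
  have hEm : ∀ n, MeasurableSet (E n) := fun n =>
    (measurableSet_lt measurable_const hg).inter (measurableSet_le hg measurable_const)
  obtain ⟨n, hn⟩ : ∃ n, μ.real (E n) ≤ ε / 2 := by
    have h0 : Tendsto (fun n => μ.real (E n)) atTop (𝓝 0) := by
      have := tendsto_measure_iInter_atTop (μ := μ) (s := E)
        (fun n => (hEm n).nullMeasurableSet)
        (fun m n hmn x hx => ⟨hx.1, hx.2.trans (add_le_add le_rfl
          (Nat.one_div_le_one_div hmn))⟩) ⟨0, measure_ne_top _ _⟩
      have hemp : ⋂ n, E n = ∅ := by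
        refine eq_empty_of_forall_notMem fun x hx => ?_
        rw [mem_iInter] at hx
        obtain ⟨n, hn⟩ := exists_nat_one_div_lt (sub_pos.mpr (hx 0).1)
        have := (hx n).2
        linarith
      rw [hemp, measure_empty] at this
      exact (ENNReal.tendsto_toReal ENNReal.zero_ne_top).comp this
    exact (h0.eventually (ge_mem_nhds (by positivity : (0 : ℝ) < ε / 2))).exists
  set δ : ℝ := 1 / ((n : ℝ) + 1) with hδ
  have hδpos : 0 < δ := by positivity
  refine ⟨fun u v => (1 / δ ^ 2) * ‖koopman hmp u h - koopman hmp v h‖ ^ 2,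
    (hh.sq fun _ _ => norm_nonneg _).const_mul (by positivity), fun u _ v _ => ?_⟩
  set F : Set X := {x | δ ^ 2 ≤ (koopman hmp u h - koopman hmp v h : Lp ℝ 2 μ) x ^ 2} with hF
  have hae : ∀ᵐ x ∂μ, (koopman hmp u h - koopman hmp v h : Lp ℝ 2 μ) x = g (T u x) - g (T v x) := by
    have h1 : ∀ w, ∀ᵐ x ∂μ, koopman hmp w h x = g (T w x) := fun w =>
      (coeFn_koopman hmp w h).trans ((hmp w).quasiMeasurePreserving.ae_eq_comp hgh)
    filter_upwards [Lp.coeFn_sub (koopman hmp u h) (koopman hmp v h), h1 u, h1 v] with x h2 h3 h4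
    rw [h2, Pi.sub_apply, h3, h4]
  have hsub : (symmDiff (T u ⁻¹' {x | c < g x}) (T v ⁻¹' {x | c < g x}) : Set X) ≤ᵐ[μ]
      (F ∪ (T u ⁻¹' E n ∪ T v ⁻¹' E n) : Set X) := by
    filter_upwards [hae] with x hx hxs
    change x ∈ F ∪ (T u ⁻¹' E n ∪ T v ⁻¹' E n)
    have hxs' : x ∈ symmDiff (T u ⁻¹' {x | c < g x}) (T v ⁻¹' {x | c < g x}) := hxs
    simp only [mem_symmDiff, mem_preimage, mem_ofPred_eq, not_lt] at hxs'
    by_cases h1 : T u x ∈ E n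
    · exact Or.inr (Or.inl h1)
    by_cases h2 : T v x ∈ E n
    · exact Or.inr (Or.inr h2)
    left
    simp only [hE, mem_ofPred_eq, not_and, not_le] at h1 h2
    simp only [hF, mem_ofPred_eq, hx]
    rcases hxs' with ⟨h3, h4⟩ | ⟨h3, h4⟩
    · have := h1 h3
      nlinarith
    · have := h2 h3
      nlinarith
  have hmE : ∀ w, μ.real (T w ⁻¹' E n) ≤ ε / 2 := fun w => by
    rw [measureReal_def, (hmp w).measure_preimage (hEm n).nullMeasurableSet]
    exact hn
  have hmF : μ.real F ≤ (1 / δ ^ 2) * ‖koopman hmp u h - koopman hmp v h‖ ^ 2 := by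
    rw [← integral_sq_eq_norm_sq, one_div, inv_mul_eq_div, le_div_iff₀' (by positivity)]
    exact mul_meas_ge_le_integral_of_nonneg (ae_of_all _ fun x => sq_nonneg _)
      (Lp.memLp _).integrable_sq _
  calc orbitDist μ T {x | c < g x} u v ≤ μ.real (F ∪ (T u ⁻¹' E n ∪ T v ⁻¹' E n)) :=
        ENNReal.toReal_mono (measure_ne_top _ _) (measure_mono_ae hsub)
    _ ≤ μ.real F + (μ.real (T u ⁻¹' E n) + μ.real (T v ⁻¹' E n)) :=
        (measureReal_union_le _ _).trans (add_le_add le_rfl (measureReal_union_le _ _))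
    _ ≤ (1 / δ ^ 2) * ‖koopman hmp u h - koopman hmp v h‖ ^ 2 + (ε / 2 + ε / 2) :=
        add_le_add hmF (add_le_add (hmE u) (hmE v))
    _ = _ := by ring

theorem AlmostPeriodic.exists_measurable (hβ : β 0 = 1) {hmp : ∀ w, MeasurePreserving (T w) μ μ}
    {h : Lp ℝ 2 μ} (hh : AlmostPeriodic β (koopman hmp) h) :
    ∃ g : X → ℝ, Measurable[dirKronAlgQ μ T β] g ∧ h =ᵐ[μ] g := by
  have hm := (Lp.aestronglyMeasurable h).stronglyMeasurable_mk.measurable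
  refine ⟨_, ?_, (Lp.aestronglyMeasurable h).ae_eq_mk⟩
  refine @measurable_of_Ioi _ _ _ _ _ (dirKronAlgQ μ T β) _ _ _ _ fun c => ?_
  exact MeasurableSpace.measurableSet_generateFrom ((mem_dirKronQ_iff hβ hmp).mpr
    ⟨measurableSet_lt measurable_const hm,
      hh.finColorable_superlevel hm (Lp.aestronglyMeasurable h).ae_eq_mk c⟩)

/-- The conditional probability of `A` given the directional Kronecker algebra. -/
noncomputable def condP (μ : Measure X) (T : (Fin q → ℤ) → X → X) (β : Fin q → ℝ) (A : Set X) :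
    X → ℝ :=
  μ[A.indicator (fun _ => (1 : ℝ)) | dirKronAlgQ μ T β]

theorem integrable_indicator_one {A : Set X} (hA : MeasurableSet A) :
    Integrable (A.indicator fun _ => (1 : ℝ)) μ :=
  (integrable_const 1).indicator hA

theorem condP_mem_Icc {A : Set X} (hA : MeasurableSet A) :
    ∀ᵐ x ∂μ, condP μ T β A x ∈ Icc (0 : ℝ) 1 := by
  have h0 : 0 ≤ᵐ[μ] condP μ T β A :=
    condExp_nonneg (ae_of_all _ fun x => indicator_nonneg (fun _ _ => zero_le_one) x)
  have h1 : condP μ T β A ≤ᵐ[μ] fun _ => (1 : ℝ) := by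
    have := condExp_mono (m := dirKronAlgQ μ T β) (integrable_indicator_one (μ := μ) hA)
      (integrable_const (1 : ℝ)) (ae_of_all _ fun x => indicator_le_self' (fun _ _ => zero_le_one) x)
    rwa [condExp_const (dirKronAlgQ_le μ T β)] at this
  filter_upwards [h0, h1] with x hx0 hx1 using ⟨hx0, hx1⟩

theorem stronglyMeasurable_condP (A : Set X) :
    StronglyMeasurable[dirKronAlgQ μ T β] (condP μ T β A) := stronglyMeasurable_condExp

theorem measurable_condP (A : Set X) : Measurable (condP μ T β A) :=
  ((stronglyMeasurable_condP A).mono (dirKronAlgQ_le μ T β)).measurable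

theorem memLp_indicator_sub_condP {A : Set X} (hA : MeasurableSet A) :
    MemLp (fun x => A.indicator (fun _ => (1 : ℝ)) x - condP μ T β A x) 2 μ := by
  refine MemLp.of_bound (C := 1) ((measurable_const.indicator hA).sub
    (measurable_condP A)).aestronglyMeasurable ?_
  filter_upwards [condP_mem_Icc (μ := μ) (T := T) (β := β) hA] with x hx
  rw [Real.norm_eq_abs, _root_.abs_le]
  have := hx.1
  have := hx.2
  by_cases hxA : x ∈ A
  · rw [indicator_of_mem hxA]
    constructor <;> linarith
  · rw [indicator_of_notMem hxA]
    constructor <;> linarith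

theorem inner_indicator_sub_condP (hβ : β 0 = 1) {hmp : ∀ w, MeasurePreserving (T w) μ μ}
    {A : Set X} (hA : MeasurableSet A) {h : Lp ℝ 2 μ} (hh : AlmostPeriodic β (koopman hmp) h) :
    ⟪(memLp_indicator_sub_condP (μ := μ) (T := T) (β := β) hA).toLp _, h⟫ = 0 := by
  obtain ⟨g, hg, hgh⟩ := hh.exists_measurable hβ
  have hgi : Integrable g μ := ((Lp.memLp h).integrable one_le_two).congr hgh
  have hgL : MemLp g 2 μ := (memLp_congr_ae hgh).mp (Lp.memLp h)
  have hbdA : ∀ᵐ x ∂μ, ‖A.indicator (fun _ => (1 : ℝ)) x‖ ≤ 1 := ae_of_all _ fun x => by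
    by_cases hx : x ∈ A <;> simp [hx]
  have hi1 : Integrable (A.indicator (fun _ => (1 : ℝ)) * g) μ :=
    hgi.bdd_mul (integrable_indicator_one hA).aestronglyMeasurable hbdA
  have hi2 : Integrable (condP μ T β A * g) μ := by
    refine hgi.bdd_mul (c := 1) (measurable_condP A).aestronglyMeasurable ?_
    filter_upwards [condP_mem_Icc (μ := μ) (T := T) (β := β) hA] with x hx
    rw [Real.norm_eq_abs, abs_of_nonneg hx.1]
    exact hx.2
  have hpull := condExp_mul_of_stronglyMeasurable_right (m := dirKronAlgQ μ T β)
    (Measurable.stronglyMeasurable hg) hi1 (integrable_indicator_one (μ := μ) hA)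
  have hint : ∫ x, A.indicator (fun _ => (1 : ℝ)) x * g x ∂μ = ∫ x, condP μ T β A x * g x ∂μ := by
    have h1 := integral_condExp (μ := μ) (dirKronAlgQ_le μ T β)
      (f := A.indicator (fun _ => (1 : ℝ)) * g)
    rw [integral_congr_ae hpull] at h1
    exact h1.symm
  rw [L2.inner_def]
  have : ∀ᵐ x ∂μ, ⟪(memLp_indicator_sub_condP (μ := μ) (T := T) (β := β) hA).toLp _ x, h x⟫ =
      A.indicator (fun _ => (1 : ℝ)) x * g x - condP μ T β A x * g x := by
    filter_upwards [hgh, (memLp_indicator_sub_condP (μ := μ) (T := T) (β := β) hA).coeFn_toLp]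
      with x h1 h2
    rw [h1, h2]
    simp only [RCLike.inner_apply, conj_trivial]
    ring
  rw [integral_congr_ae this, integral_sub (f := fun x => A.indicator (fun _ => (1 : ℝ)) x * g x)
    (g := fun x => condP μ T β A x * g x) hi1 hi2]
  exact sub_eq_zero.mpr hint

/-- Conditionally on the directional Kronecker algebra, a set becomes asymptotically independent
of finitely many others along some arbitrarily far elements of the tube. -/
theorem exists_measure_inter_preimage_close (hβ : β 0 = 1) (h0 : T 0 = _root_.id)
    (hadd : ∀ v w, T (v + w) = T v ∘ T w) (hmp : ∀ w, MeasurePreserving (T w) μ μ)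
    {α P : Finset (Set X)} (hα : ∀ A ∈ α, MeasurableSet A) (hP : ∀ D ∈ P, MeasurableSet D)
    {ε δ : ℝ} (hε : 0 < ε) (hδ : 0 < δ) (N : ℤ) :
    ∃ w, ‖dev β w‖ ≤ δ ∧ N < w 0 ∧ ∀ D ∈ P, ∀ A ∈ α,
      |μ.real (D ∩ T w ⁻¹' A) - ∫ x in D, condP μ T β A (T w x) ∂μ| < ε := by
  classical
  set f : Set X × Set X → Lp ℝ 2 μ := fun p => if hp : MeasurableSet p.2 then
    (memLp_indicator_sub_condP (μ := μ) (T := T) (β := β) hp).toLp _ else 0 with hf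
  set g : Set X × Set X → Lp ℝ 2 μ := fun p => if hp : MeasurableSet p.1 then
    indicatorConstLp 2 hp (measure_ne_top μ _) 1 else 0 with hg
  obtain ⟨w, hw1, hw2, hw3⟩ := exists_weakly_small (β := β) (U := koopman hmp) hβ
    (koopman_zero h0 hmp) (koopman_add hadd hmp) (P ×ˢ α) f g (by
      rintro ⟨D, A⟩ hDA h hh
      obtain ⟨-, hA⟩ := Finset.mem_product.mp hDA
      simp only [hf, dif_pos (hα A hA)]
      exact inner_indicator_sub_condP hβ (hα A hA) hh) hε hδ N
  refine ⟨w, hw1, hw2, fun D hD A hA => ?_⟩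
  have key := hw3 (D, A) (Finset.mk_mem_product hD hA)
  have hAm := hα A hA
  have hDm := hP D hD
  simp only [hf, hg, dif_pos hAm, dif_pos hDm] at key
  rw [L2.inner_indicatorConstLp_one] at key
  have hae : ∀ᵐ x ∂μ, koopman hmp w ((memLp_indicator_sub_condP (μ := μ) (T := T) (β := β)
      hAm).toLp _) x = (T w ⁻¹' A).indicator (fun _ => (1 : ℝ)) x - condP μ T β A (T w x) :=
    (coeFn_koopman hmp w _).trans ((hmp w).quasiMeasurePreserving.ae_eq_comp
      (memLp_indicator_sub_condP (μ := μ) (T := T) (β := β) hAm).coeFn_toLp)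
  have hi : Integrable (fun x => condP μ T β A (T w x)) μ :=
    (hmp w).integrable_comp_of_integrable integrable_condExp
  rw [setIntegral_congr_ae hDm (hae.mono fun x hx _ => hx), integral_sub
    (integrable_indicator_one ((hmp w).measurable hAm)).integrableOn hi.integrableOn,
    setIntegral_indicator ((hmp w).measurable hAm)] at key
  simpa using key

end Koopman

/-! ### Entropy of finite-valued functions -/

section Entropy

open Real in
/-- Strong subadditivity for a nonnegative matrix and its marginals. -/
theorem sum_negMulLog_add_le {ι κ : Type*} [Fintype ι] [Fintype κ] (p : ι → κ → ℝ)
    (hp : ∀ i j, 0 ≤ p i j) :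
    (∑ i, ∑ j, negMulLog (p i j)) + negMulLog (∑ i, ∑ j, p i j) ≤
      (∑ i, negMulLog (∑ j, p i j)) + ∑ j, negMulLog (∑ i, p i j) := by
  set a : ι → ℝ := fun i => ∑ j, p i j with ha
  set b : κ → ℝ := fun j => ∑ i, p i j with hb
  set s : ℝ := ∑ i, ∑ j, p i j with hs
  have hbs : ∑ j, b j = s := by rw [hs, Finset.sum_comm]
  have ha0 : ∀ i, 0 ≤ a i := fun i => Finset.sum_nonneg fun j _ => hp i j
  have hb0 : ∀ j, 0 ≤ b j := fun j => Finset.sum_nonneg fun i _ => hp i j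
  have hpa : ∀ i j, p i j ≤ a i := fun i j =>
    Finset.single_le_sum (fun j _ => hp i j) (Finset.mem_univ j)
  have hpb : ∀ i j, p i j ≤ b j := fun i j =>
    Finset.single_le_sum (fun i _ => hp i j) (Finset.mem_univ i)
  have has : ∀ i, a i ≤ s := fun i => Finset.single_le_sum (fun i _ => ha0 i) (Finset.mem_univ i)
  have hs0 : 0 ≤ s := Finset.sum_nonneg fun i _ => ha0 i
  have key : ∀ i j, negMulLog (p i j) ≤
      (-(p i j * log (a i)) - p i j * log (b j) + p i j * log s) + (a i * b j / s - p i j) := by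
    intro i j
    rcases (hp i j).eq_or_lt with h0 | h0
    · rw [← h0]
      simp only [negMulLog_zero, zero_mul, neg_zero, sub_zero, add_zero, zero_add]
      exact div_nonneg (mul_nonneg (ha0 i) (hb0 j)) hs0
    · have h1 := h0.trans_le (hpa i j)
      have h2 := h0.trans_le (hpb i j)
      have h3 := h1.trans_le (has i)
      have h4 := log_le_sub_one_of_pos (show 0 < a i * b j / (p i j * s) by positivity)
      rw [log_div (by positivity) (by positivity), log_mul h1.ne' h2.ne', log_mul h0.ne' h3.ne']
        at h4
      have h5 := mul_le_mul_of_nonneg_left h4 h0.le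
      have h6 : p i j * (a i * b j / (p i j * s) - 1) = a i * b j / s - p i j := by
        field_simp
      rw [h6] at h5
      rw [negMulLog]
      linarith
  have hsum : ∑ i, ∑ j, negMulLog (p i j) ≤ ∑ i, ∑ j,
      ((-(p i j * log (a i)) - p i j * log (b j) + p i j * log s) + (a i * b j / s - p i j)) :=
    Finset.sum_le_sum fun i _ => Finset.sum_le_sum fun j _ => key i j
  simp only [Finset.sum_add_distrib, Finset.sum_sub_distrib, Finset.sum_neg_distrib] at hsum
  have e1 : ∑ i, ∑ j, p i j * log (a i) = ∑ i, a i * log (a i) := by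
    simp only [← Finset.sum_mul, ha]
  have e2 : ∑ i, ∑ j, p i j * log (b j) = ∑ j, b j * log (b j) := by
    rw [Finset.sum_comm]
    simp only [← Finset.sum_mul, hb]
  have e3 : ∑ i, ∑ j, p i j * log s = s * log s := by
    simp only [← Finset.sum_mul, hs]
  have e4 : ∑ i, ∑ j, a i * b j / s = s := by
    simp only [← Finset.sum_div, ← Finset.mul_sum, ← Finset.sum_mul, hbs]
    rw [show ∑ i, a i = s from rfl, mul_self_div_self]
  rw [e1, e2, e3, e4] at hsum
  have e5 : ∑ i, negMulLog (a i) = -∑ i, a i * log (a i) := by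
    simp only [negMulLog, neg_mul, Finset.sum_neg_distrib]
  have e6 : ∑ j, negMulLog (b j) = -∑ j, b j * log (b j) := by
    simp only [negMulLog, neg_mul, Finset.sum_neg_distrib]
  have e7 : negMulLog s = -(s * log s) := by rw [negMulLog, neg_mul]
  rw [e5, e6, e7]
  linarith

open Real in
theorem negMulLog_sum_le {ι : Type*} (t : Finset ι) {p : ι → ℝ} (hp : ∀ i ∈ t, 0 ≤ p i) :
    negMulLog (∑ i ∈ t, p i) ≤ ∑ i ∈ t, negMulLog (p i) := by
  rw [negMulLog, neg_mul, Finset.sum_mul, ← Finset.sum_neg_distrib]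
  refine Finset.sum_le_sum fun i hi => ?_
  rw [negMulLog, neg_mul, neg_le_neg_iff]
  rcases (hp i hi).eq_or_lt with h0 | h0
  · rw [← h0]
    simp
  · exact mul_le_mul_of_nonneg_left (log_le_log h0 (Finset.single_le_sum hp hi)) h0.le

open Real in
theorem mul_negMulLog_div {y z : ℝ} (hy : 0 < y) :
    y * negMulLog (z / y) = negMulLog z + z * log y := by
  rcases eq_or_ne z 0 with rfl | hz
  · simp
  · rw [negMulLog, negMulLog, log_div hz hy.ne']
    field_simp
    ring

theorem exists_negMulLog_modulus {ε : ℝ} (hε : 0 < ε) : ∃ δ > 0, ∀ x ∈ Icc (0 : ℝ) 1,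
    ∀ y ∈ Icc (0 : ℝ) 1, |x - y| ≤ δ → |Real.negMulLog x - Real.negMulLog y| ≤ ε := by
  have h := (isCompact_Icc (a := (0 : ℝ)) (b := 1)).uniformContinuousOn_of_continuous
    Real.continuous_negMulLog.continuousOn
  obtain ⟨δ, hδ, H⟩ := Metric.uniformContinuousOn_iff.mp h ε hε
  refine ⟨δ / 2, by positivity, fun x hx y hy hxy => ?_⟩
  exact (H x hx y hy (by rw [Real.dist_eq]; linarith)).le

variable {X : Type*} [MeasurableSpace X] {μ : Measure X}
  {ι κ σ : Type*} [Fintype ι] [Fintype κ] [Fintype σ]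

/-- The Shannon entropy of a finite-valued function. -/
noncomputable def ent (μ : Measure X) (f : X → ι) : ℝ :=
  ∑ i, Real.negMulLog (μ.real (f ⁻¹' {i}))

/-- The conditional entropy of `f` given `g`. -/
noncomputable def condEnt (μ : Measure X) (f : X → ι) (g : X → κ) : ℝ :=
  ent μ (fun x => (f x, g x)) - ent μ g

/-- All preimages under `f` are measurable. -/
def DiscMeasurable {ι : Type*} (f : X → ι) : Prop := ∀ s : Set ι, MeasurableSet (f ⁻¹' s)

theorem DiscMeasurable.of_singleton {f : X → ι} (h : ∀ i, MeasurableSet (f ⁻¹' {i})) :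
    DiscMeasurable f := fun s => by
  have : f ⁻¹' s = ⋃ i ∈ s, f ⁻¹' {i} := by
    rw [← preimage_iUnion₂, biUnion_of_singleton]
  rw [this]
  exact MeasurableSet.biUnion (to_countable s) fun i _ => h i

theorem DiscMeasurable.prodMk {f : X → ι} {g : X → κ} (hf : DiscMeasurable f)
    (hg : DiscMeasurable g) : DiscMeasurable fun x => (f x, g x) :=
  .of_singleton fun i => by
    have : (fun x => (f x, g x)) ⁻¹' {i} = f ⁻¹' {i.1} ∩ g ⁻¹' {i.2} := by
      ext x
      simp [Prod.ext_iff]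
    rw [this]
    exact (hf _).inter (hg _)

theorem DiscMeasurable.pi {f : ι → X → κ} (hf : ∀ i, DiscMeasurable (f i)) :
    DiscMeasurable fun x i => f i x := by
  classical
  exact .of_singleton fun c => by
    have : (fun x i => f i x) ⁻¹' {c} = ⋂ i, f i ⁻¹' {c i} := by
      ext x
      simp [funext_iff]
    rw [this]
    exact MeasurableSet.iInter fun i => hf i _

theorem DiscMeasurable.comp_measurable {ι : Type*} {f : X → ι} (hf : DiscMeasurable f) {S : X → X}
    (hS : Measurable S) : DiscMeasurable (f ∘ S) := fun s => hS (hf s)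

theorem measureReal_eq_sum_inter [IsFiniteMeasure μ] {f : X → ι} (hf : DiscMeasurable f)
    (B : Set X) : μ.real B = ∑ i, μ.real (f ⁻¹' {i} ∩ B) := by
  have h := measureReal_biUnion_finset₀ (μ := μ.restrict B) (s := Finset.univ)
    (f := fun i => f ⁻¹' {i}) (fun i _ j _ hij => (disjoint_singleton.mpr hij).preimage f |>.aedisjoint)
    (fun i _ => (hf {i}).nullMeasurableSet)
  have hU : ⋃ i ∈ Finset.univ, f ⁻¹' {i} = univ := by
    ext x
    simp
  rw [hU, measureReal_restrict_apply MeasurableSet.univ, univ_inter] at h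
  rw [h]
  exact Finset.sum_congr rfl fun i _ => measureReal_restrict_apply (hf {i})

theorem ent_prod (f : X → ι) (g : X → κ) : ent μ (fun x => (f x, g x)) =
    ∑ j, ∑ i, Real.negMulLog (μ.real (f ⁻¹' {i} ∩ g ⁻¹' {j})) := by
  rw [ent, Fintype.sum_prod_type_right]
  refine Finset.sum_congr rfl fun j _ => Finset.sum_congr rfl fun i _ => ?_
  congr 2
  ext x
  simp

theorem ent_prod_of_determines [IsFiniteMeasure μ] {f : X → ι} {g : X → κ}
    (h : ∀ x y, f x = f y → g x = g y) : ent μ (fun x => (f x, g x)) = ent μ f := by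
  rw [ent_prod, Finset.sum_comm, ent]
  refine Finset.sum_congr rfl fun i _ => ?_
  rcases (f ⁻¹' {i}).eq_empty_or_nonempty with h0 | ⟨x, hx⟩
  · simp [h0]
  · rw [Finset.sum_eq_single (g x)]
    · congr 2
      exact inter_eq_left.mpr fun y hy => h y x ((hy : f y = i).trans (hx : f x = i).symm)
    · intro j _ hj
      have : f ⁻¹' {i} ∩ g ⁻¹' {j} = ∅ := by
        refine eq_empty_of_forall_notMem fun y hy => hj ?_
        rw [← (hy.2 : g y = j)]
        exact h y x ((hy.1 : f y = i).trans (hx : f x = i).symm)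
      simp [this]
    · exact fun hn => absurd (Finset.mem_univ _) hn

theorem ent_le_ent_prod [IsFiniteMeasure μ] {f : X → ι} (hf : DiscMeasurable f) (g : X → κ) :
    ent μ g ≤ ent μ (fun x => (f x, g x)) := by
  rw [ent_prod, ent]
  refine Finset.sum_le_sum fun j _ => ?_
  rw [measureReal_eq_sum_inter hf (g ⁻¹' {j})]
  exact negMulLog_sum_le _ fun i _ => measureReal_nonneg

theorem ent_le_of_determines [IsFiniteMeasure μ] {f : X → ι} (hf : DiscMeasurable f) {g : X → κ}
    (h : ∀ x y, f x = f y → g x = g y) : ent μ g ≤ ent μ f :=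
  (ent_le_ent_prod hf g).trans_eq (ent_prod_of_determines h)

theorem ent_congr [IsFiniteMeasure μ] {f : X → ι} (hf : DiscMeasurable f) {g : X → κ}
    (hg : DiscMeasurable g) (h : ∀ x y, f x = f y ↔ g x = g y) : ent μ f = ent μ g :=
  le_antisymm (ent_le_of_determines hg fun x y => (h x y).mpr)
    (ent_le_of_determines hf fun x y => (h x y).mp)

theorem ent_strong_subadditive [IsFiniteMeasure μ] {f : X → ι} (hf : DiscMeasurable f) {g : X → κ}
    (hg : DiscMeasurable g) (h : X → σ) :
    ent μ (fun x => (f x, g x, h x)) + ent μ h ≤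
      ent μ (fun x => (f x, h x)) + ent μ (fun x => (g x, h x)) := by
  have h1 : ent μ (fun x => (f x, g x, h x)) =
      ∑ k, ∑ i, ∑ j, Real.negMulLog (μ.real (f ⁻¹' {i} ∩ (g ⁻¹' {j} ∩ h ⁻¹' {k}))) := by
    rw [ent_prod, Fintype.sum_prod_type_right]
    refine Finset.sum_congr rfl fun k _ => ?_
    rw [Finset.sum_comm]
    refine Finset.sum_congr rfl fun i _ => Finset.sum_congr rfl fun j _ => ?_
    congr 3
    ext x
    simp
  rw [h1, ent_prod, ent_prod, ent, ← Finset.sum_add_distrib, ← Finset.sum_add_distrib]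
  refine Finset.sum_le_sum fun k _ => ?_
  have h2 := sum_negMulLog_add_le (fun i j => μ.real (f ⁻¹' {i} ∩ (g ⁻¹' {j} ∩ h ⁻¹' {k})))
    fun i j => measureReal_nonneg
  have e1 : ∀ i, ∑ j, μ.real (f ⁻¹' {i} ∩ (g ⁻¹' {j} ∩ h ⁻¹' {k})) =
      μ.real (f ⁻¹' {i} ∩ h ⁻¹' {k}) := fun i => by
    rw [measureReal_eq_sum_inter hg (f ⁻¹' {i} ∩ h ⁻¹' {k})]
    exact Finset.sum_congr rfl fun j _ => by rw [inter_left_comm]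
  have e2 : ∀ j, ∑ i, μ.real (f ⁻¹' {i} ∩ (g ⁻¹' {j} ∩ h ⁻¹' {k})) =
      μ.real (g ⁻¹' {j} ∩ h ⁻¹' {k}) := fun j => (measureReal_eq_sum_inter hf _).symm
  simp only [e1, e2] at h2
  rwa [← measureReal_eq_sum_inter hf] at h2

theorem condEnt_le_of_determines [IsFiniteMeasure μ] {f : X → ι} (hf : DiscMeasurable f) {g : X → κ}
    (hg : DiscMeasurable g) {g' : X → σ} (hg' : DiscMeasurable g')
    (h : ∀ x y, g x = g y → g' x = g' y) : condEnt μ f g ≤ condEnt μ f g' := by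
  have h1 := ent_strong_subadditive (μ := μ) hf hg g'
  have h2 : ent μ (fun x => (g x, g' x)) = ent μ g := ent_prod_of_determines h
  have h3 : ent μ (fun x => (f x, g x, g' x)) = ent μ (fun x => (f x, g x)) :=
    ent_congr (hf.prodMk (hg.prodMk hg')) (hf.prodMk hg) fun x y => by
      simp only [Prod.mk.injEq]
      exact ⟨fun h => ⟨h.1, h.2.1⟩, fun hh => ⟨hh.1, hh.2, h x y hh.2⟩⟩
  rw [h2, h3] at h1
  rw [condEnt, condEnt]
  linarith

theorem ent_le_card (f : X → ι) : ent μ f ≤ Fintype.card ι := by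
  refine (Finset.sum_le_sum fun i _ => (Real.negMulLog_le_one_sub_self measureReal_nonneg).trans
    (sub_le_self 1 measureReal_nonneg)).trans ?_
  simp

theorem ent_nonneg [IsProbabilityMeasure μ] (f : X → ι) : 0 ≤ ent μ f :=
  Finset.sum_nonneg fun _ _ => Real.negMulLog_nonneg measureReal_nonneg measureReal_le_one

theorem condEnt_le_card [IsProbabilityMeasure μ] {f : X → ι} (hf : DiscMeasurable f) {g : X → κ}
    (hg : DiscMeasurable g) : condEnt μ f g ≤ Fintype.card ι := by
  have hu : DiscMeasurable fun _ : X => () := fun s =>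
    (measurable_const : Measurable fun _ : X => ()) (.of_discrete (s := s))
  refine (condEnt_le_of_determines hf hg hu fun _ _ _ => rfl).trans ?_
  rw [condEnt, ent_prod_of_determines fun _ _ _ => rfl]
  exact (sub_le_self _ (ent_nonneg _)).trans (ent_le_card f)

theorem ent_comp {S : X → X} (hS : MeasurePreserving S μ μ) {f : X → ι} (hf : DiscMeasurable f) :
    ent μ (f ∘ S) = ent μ f := by
  refine Finset.sum_congr rfl fun i _ => ?_
  rw [preimage_comp, measureReal_def, hS.measure_preimage (hf {i}).nullMeasurableSet]
  rfl

theorem condEnt_comp {S : X → X} (hS : MeasurePreserving S μ μ) {f : X → ι}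
    (hf : DiscMeasurable f) {g : X → κ} (hg : DiscMeasurable g) :
    condEnt μ (f ∘ S) (g ∘ S) = condEnt μ f g := by
  rw [condEnt, condEnt, ent_comp hS hg]
  congr 1
  exact ent_comp hS (hf.prodMk hg)

theorem condEnt_eq_sum (f : X → ι) (g : X → κ) : condEnt μ f g =
    ∑ j, ((∑ i, Real.negMulLog (μ.real (f ⁻¹' {i} ∩ g ⁻¹' {j}))) -
      Real.negMulLog (μ.real (g ⁻¹' {j}))) := by
  rw [condEnt, ent_prod, ent, Finset.sum_sub_distrib]

/-- Functions with close fibres have small conditional entropy. -/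
theorem exists_condEnt_le (ι : Type*) [Fintype ι] {ε : ℝ} (hε : 0 < ε) : ∃ δ > 0,
    ∀ (μ : Measure X) [IsProbabilityMeasure μ] (f g : X → ι), DiscMeasurable f →
      (∀ i, μ.real (symmDiff (f ⁻¹' {i}) (g ⁻¹' {i})) ≤ δ) → condEnt μ f g ≤ ε := by
  classical
  set n : ℝ := (Fintype.card ι : ℝ)
  obtain ⟨δ, hδ, H⟩ := exists_negMulLog_modulus (show 0 < ε / (n * n + 1) by positivity)
  refine ⟨δ, hδ, fun μ _ f g hf hfg => ?_⟩
  have hI : ∀ B : Set X, μ.real B ∈ Icc (0 : ℝ) 1 := fun B => ⟨measureReal_nonneg, measureReal_le_one⟩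
  have hj : ∀ j, (∑ i, Real.negMulLog (μ.real (f ⁻¹' {i} ∩ g ⁻¹' {j}))) -
      Real.negMulLog (μ.real (g ⁻¹' {j})) ≤ n * (ε / (n * n + 1)) := by
    intro j
    have hi : ∀ i, Real.negMulLog (μ.real (f ⁻¹' {i} ∩ g ⁻¹' {j})) ≤
        (if i = j then Real.negMulLog (μ.real (g ⁻¹' {j})) else 0) + ε / (n * n + 1) := by
      intro i
      split_ifs with hij
      · subst hij
        have h1 : |μ.real (f ⁻¹' {i} ∩ g ⁻¹' {i}) - μ.real (g ⁻¹' {i})| ≤ δ := by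
          have h2 := measureReal_inter_add_sdiff₀ (μ := μ) (s := g ⁻¹' {i})
            (t := f ⁻¹' {i}) (hf {i}).nullMeasurableSet
          have h3 : μ.real (g ⁻¹' {i} \ f ⁻¹' {i}) ≤ δ :=
            (measureReal_mono subset_union_right).trans (hfg i)
          rw [inter_comm, abs_sub_comm, ← h2, add_sub_cancel_left, abs_of_nonneg measureReal_nonneg]
          exact h3
        have h4 := (abs_le.mp (H _ (hI _) _ (hI _) h1)).2
        linarith
      · have h1 : |μ.real (f ⁻¹' {i} ∩ g ⁻¹' {j}) - 0| ≤ δ := by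
          rw [sub_zero, abs_of_nonneg measureReal_nonneg]
          refine (measureReal_mono ?_).trans (hfg i)
          refine fun x hx => Or.inl ⟨hx.1, fun hx' => hij ?_⟩
          exact (hx' : g x = i).symm.trans hx.2
        have h4 := (abs_le.mp (H _ (hI _) 0 ⟨le_rfl, zero_le_one⟩ h1)).2
        rw [Real.negMulLog_zero, sub_zero] at h4
        linarith
    have h2 := Finset.sum_le_sum fun i (_ : i ∈ Finset.univ) => hi i
    rw [Finset.sum_add_distrib, Finset.sum_ite_eq' Finset.univ j, if_pos (Finset.mem_univ j),
      Finset.sum_const, Finset.card_univ, nsmul_eq_mul] at h2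
    linarith
  rw [condEnt_eq_sum]
  refine (Finset.sum_le_sum fun j _ => hj j).trans ?_
  rw [Finset.sum_const, Finset.card_univ, nsmul_eq_mul, ← mul_assoc, ← mul_div_assoc,
    div_le_iff₀ (by positivity)]
  nlinarith

end Entropy

/-! ### Entropy of partitions -/

section PartitionEntropy

variable {X : Type*} [MeasurableSpace X] {μ : Measure X}

theorem IsPartition.exists_label {α : Finset (Set X)} (hα : IsPartition α) :
    ∃ lab : X → α, ∀ A : α, lab ⁻¹' {A} = (A : Set X) := by
  have h : ∀ x, ∃ A : α, x ∈ (A : Set X) := fun x => by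
    have : x ∈ ⋃₀ (α : Set (Set X)) := hα.2.2 ▸ mem_univ x
    obtain ⟨A, hA, hx⟩ := this
    exact ⟨⟨A, hA⟩, hx⟩
  choose lab hlab using h
  refine ⟨lab, fun A => Subset.antisymm (fun x hx => ?_) fun x hx => ?_⟩
  · rw [← (hx : lab x = A)]
    exact hlab x
  · by_contra hne
    exact (hα.2.1 (lab x).2 A.2 fun h => hne (Subtype.ext h)).le_bot ⟨hlab x, hx⟩

/-- The labelling of points by cells of a partition. -/
noncomputable def IsPartition.label {α : Finset (Set X)} (hα : IsPartition α) : X → α :=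
  hα.exists_label.choose

theorem IsPartition.label_preimage {α : Finset (Set X)} (hα : IsPartition α) (A : α) :
    hα.label ⁻¹' {A} = (A : Set X) :=
  hα.exists_label.choose_spec A

theorem IsPartition.mem_label {α : Finset (Set X)} (hα : IsPartition α) (x : X) :
    x ∈ (hα.label x : Set X) := by
  rw [← hα.label_preimage (hα.label x)]
  rfl

theorem IsPartition.label_eq {α : Finset (Set X)} (hα : IsPartition α) {x : X} {A : Set X}
    (hA : A ∈ α) (hx : x ∈ A) : hα.label x = ⟨A, hA⟩ := by
  have : x ∈ hα.label ⁻¹' {⟨A, hA⟩} := by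
    rw [hα.label_preimage]
    exact hx
  exact this

theorem IsPartition.discMeasurable_label {α : Finset (Set X)} (hα : IsPartition α) :
    DiscMeasurable hα.label :=
  .of_singleton fun A => by
    rw [hα.label_preimage]
    exact hα.1 _ A.2

theorem IsPartition.partEnt_eq_ent {α : Finset (Set X)} (hα : IsPartition α) :
    partEnt μ α = ent μ hα.label := by
  rw [partEnt, ent, ← Finset.sum_coe_sort]
  exact Finset.sum_congr rfl fun A _ => by
    rw [hα.label_preimage]
    rfl

open Classical in
/-- The join of a partition `P` with the pullback of `α` under `S`. -/
noncomputable def joinPart (S : X → X) (P α : Finset (Set X)) : Finset (Set X) :=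
  (P ×ˢ α).image fun p => p.1 ∩ (S ⁻¹' p.2)

theorem mem_joinPart {S : X → X} {P α : Finset (Set X)} {B : Set X} :
    B ∈ joinPart S P α ↔ ∃ D ∈ P, ∃ A ∈ α, D ∩ S ⁻¹' A = B := by
  simp only [joinPart, Finset.mem_image, Finset.mem_product, Prod.exists]
  exact ⟨fun ⟨D, A, ⟨hD, hA⟩, h⟩ => ⟨D, hD, A, hA, h⟩, fun ⟨D, hD, A, hA, h⟩ => ⟨D, A, ⟨hD, hA⟩, h⟩⟩

theorem IsPartition.joinPart {S : X → X} (hS : Measurable S) {P α : Finset (Set X)}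
    (hP : IsPartition P) (hα : IsPartition α) : IsPartition (joinPart S P α) := by
  refine ⟨fun B hB => ?_, fun B hB B' hB' hne => ?_, ?_⟩
  · obtain ⟨D, hD, A, hA, rfl⟩ := mem_joinPart.mp hB
    exact (hP.1 D hD).inter (hS (hα.1 A hA))
  · obtain ⟨D, hD, A, hA, rfl⟩ := mem_joinPart.mp (Finset.mem_coe.mp hB)
    obtain ⟨D', hD', A', hA', rfl⟩ := mem_joinPart.mp (Finset.mem_coe.mp hB')
    refine Set.disjoint_left.mpr fun x hx hx' => hne ?_
    have h1 : D = D' := by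
      by_contra h
      exact (hP.2.1 hD hD' h).le_bot ⟨hx.1, hx'.1⟩
    have h2 : A = A' := by
      by_contra h
      exact (hα.2.1 hA hA' h).le_bot ⟨hx.2, hx'.2⟩
    rw [h1, h2]
  · refine eq_univ_of_forall fun x => ?_
    exact ⟨_, Finset.mem_coe.mpr (mem_joinPart.mpr ⟨_, (hP.label x).2, _, (hα.label (S x)).2, rfl⟩),
      hP.mem_label x, hα.mem_label (S x)⟩

theorem partEnt_joinPart [IsFiniteMeasure μ] {S : X → X} (hS : Measurable S) {P α : Finset (Set X)}
    (hP : IsPartition P) (hα : IsPartition α) : partEnt μ (joinPart S P α) =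
      ∑ D ∈ P, ∑ A ∈ α, Real.negMulLog (μ.real (D ∩ S ⁻¹' A)) := by
  have hQ := hP.joinPart hS hα
  have h1 : ent μ hQ.label = ent μ fun x => (hα.label (S x), hP.label x) := by
    refine ent_congr hQ.discMeasurable_label
      ((hα.discMeasurable_label.comp_measurable hS).prodMk hP.discMeasurable_label) fun x y => ?_
    rw [Prod.mk.injEq]
    constructor
    · intro h
      obtain ⟨D, hD, A, hA, hDA⟩ := mem_joinPart.mp (hQ.label x).2
      have hx := hQ.mem_label x
      have hy := hQ.mem_label y
      rw [← h, ← hDA] at hy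
      rw [← hDA] at hx
      rw [hα.label_eq hA hx.2, hα.label_eq hA hy.2, hP.label_eq hD hx.1, hP.label_eq hD hy.1]
      exact ⟨rfl, rfl⟩
    · rintro ⟨h2, h3⟩
      have hB : (hP.label x : Set X) ∩ S ⁻¹' (hα.label (S x) : Set X) ∈ joinPart S P α :=
        mem_joinPart.mpr ⟨_, (hP.label x).2, _, (hα.label (S x)).2, rfl⟩
      have hx := hQ.label_eq hB ⟨hP.mem_label x, hα.mem_label (S x)⟩
      have hy := hQ.label_eq hB (x := y) ⟨h3 ▸ hP.mem_label y, h2 ▸ hα.mem_label (S y)⟩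
      exact hx.trans hy.symm
  rw [hQ.partEnt_eq_ent, h1, ent_prod (fun x => hα.label (S x)) hP.label, ← Finset.sum_coe_sort P]
  refine Finset.sum_congr rfl fun D _ => ?_
  rw [← Finset.sum_coe_sort α]
  refine Finset.sum_congr rfl fun A _ => ?_
  congr 2
  rw [hP.label_preimage, inter_comm, ← hα.label_preimage A]
  rfl

theorem integrable_of_mem_Icc [IsFiniteMeasure μ] {E : X → ℝ} (hE : Measurable E)
    (h : ∀ᵐ x ∂μ, E x ∈ Icc (0 : ℝ) 1) : Integrable E μ :=
  .of_mem_Icc 0 1 hE.aemeasurable h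

theorem negMulLog_mem_Icc {t : ℝ} (ht : t ∈ Icc (0 : ℝ) 1) : Real.negMulLog t ∈ Icc (0 : ℝ) 1 :=
  ⟨Real.negMulLog_nonneg ht.1 ht.2,
    (Real.negMulLog_le_one_sub_self ht.1).trans (sub_le_self _ ht.1)⟩

theorem integrable_negMulLog [IsFiniteMeasure μ] {E : X → ℝ} (hE : Measurable E)
    (h : ∀ᵐ x ∂μ, E x ∈ Icc (0 : ℝ) 1) : Integrable (fun x => Real.negMulLog (E x)) μ :=
  integrable_of_mem_Icc (Real.continuous_negMulLog.measurable.comp hE)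
    (h.mono fun _ hx => negMulLog_mem_Icc hx)

theorem setIntegral_negMulLog_le [IsFiniteMeasure μ] {E : X → ℝ} (hE : Measurable E)
    (h : ∀ᵐ x ∂μ, E x ∈ Icc (0 : ℝ) 1) (D : Set X) :
    ∫ x in D, Real.negMulLog (E x) ∂μ ≤
      Real.negMulLog (∫ x in D, E x ∂μ) + (∫ x in D, E x ∂μ) * Real.log (μ.real D) := by
  rcases eq_or_ne (μ D) 0 with h0 | h0
  · simp [Measure.restrict_eq_zero.mpr h0]
  have hpos : 0 < μ.real D := ENNReal.toReal_pos h0 (measure_ne_top _ _)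
  have hJ := Real.concaveOn_negMulLog.le_map_set_average (μ := μ) (t := D) (f := E)
    Real.continuous_negMulLog.continuousOn isClosed_Ici h0 (measure_ne_top _ _)
    (ae_restrict_of_ae (h.mono fun x hx => hx.1)) (integrable_of_mem_Icc hE h).integrableOn
    (integrable_negMulLog hE h).integrableOn
  rw [setAverage_eq, setAverage_eq, smul_eq_mul, smul_eq_mul, inv_mul_eq_div, inv_mul_eq_div,
    div_le_iff₀' hpos, mul_negMulLog_div hpos] at hJ
  exact hJ

theorem le_setIntegral_negMulLog [IsFiniteMeasure μ] {E : X → ℝ} (hE : Measurable E)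
    (h : ∀ᵐ x ∂μ, E x ∈ Icc (0 : ℝ) 1) {D : Set X} {ε δ : ℝ}
    (H : ∀ x ∈ Icc (0 : ℝ) 1, ∀ y ∈ Icc (0 : ℝ) 1, |x - y| ≤ δ →
      |Real.negMulLog x - Real.negMulLog y| ≤ ε) (t : ℝ)
    (ht : ∀ᵐ x ∂μ.restrict D, E x ∈ Icc t (t + δ)) :
    Real.negMulLog (∫ x in D, E x ∂μ) + (∫ x in D, E x ∂μ) * Real.log (μ.real D) ≤
      (∫ x in D, Real.negMulLog (E x) ∂μ) + ε * μ.real D := by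
  rcases eq_or_ne (μ D) 0 with h0 | h0
  · simp [Measure.restrict_eq_zero.mpr h0, measureReal_def, h0]
  have hpos : 0 < μ.real D := ENNReal.toReal_pos h0 (measure_ne_top _ _)
  have : NeZero (μ.restrict D) := ⟨by rwa [Ne, Measure.restrict_eq_zero]⟩
  have hi := (integrable_of_mem_Icc hE h).integrableOn (s := D)
  have havg : ∀ {a b : ℝ}, (∀ᵐ x ∂μ.restrict D, E x ∈ Icc a b) →
      (∫ x in D, E x ∂μ) / μ.real D ∈ Icc a b := fun {a b} hab => by
    have := (convex_Icc a b).average_mem isClosed_Icc hab hi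
    rwa [setAverage_eq, smul_eq_mul, inv_mul_eq_div] at this
  have h1 := havg (ae_restrict_of_ae h)
  have h2 := havg ht
  rw [← mul_negMulLog_div hpos]
  have h3 : ∫ x in D, Real.negMulLog ((∫ x in D, E x ∂μ) / μ.real D) ∂μ ≤
      ∫ x in D, (Real.negMulLog (E x) + ε) ∂μ := by
    refine integral_mono_ae (integrable_const _)
      ((integrable_negMulLog hE h).integrableOn.add (integrable_const _)) ?_
    filter_upwards [ht, ae_restrict_of_ae h] with x hx hx'
    have h4 := (abs_le.mp (H _ h1 _ hx' (abs_le.mpr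
      ⟨by linarith [h2.1, hx.2], by linarith [h2.2, hx.1]⟩))).2
    linarith
  rw [integral_add (integrable_negMulLog hE h).integrableOn (integrable_const _),
    setIntegral_const, setIntegral_const, smul_eq_mul, smul_eq_mul, mul_comm (μ.real D) ε] at h3
  exact h3

end PartitionEntropy

/-! ### The entropy gained along the sequence -/

section Gain

variable {X : Type*} [mX : MeasurableSpace X] {q : ℕ} [NeZero q] {μ : Measure X}
  [IsProbabilityMeasure μ] {T : (Fin q → ℤ) → X → X} {β : Fin q → ℝ} {α : Finset (Set X)}

theorem sum_condP_ae_eq_one (hα : IsPartition α) :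
    ∀ᵐ x ∂μ, ∑ A ∈ α, condP μ T β A x = 1 := by
  have h := condExp_finsetSum (μ := μ) (s := α) (f := fun A => A.indicator fun _ => (1 : ℝ))
    (fun A hA => integrable_indicator_one (hα.1 A hA)) (dirKronAlgQ μ T β)
  have h1 : ∑ A ∈ α, A.indicator (fun _ => (1 : ℝ)) = fun _ : X => (1 : ℝ) := by
    ext x
    rw [Finset.sum_apply, Finset.sum_eq_single_of_mem _ (hα.label x).2,
      indicator_of_mem (hα.mem_label x)]
    intro A hA hne
    refine indicator_of_notMem (fun hx => hne ?_) _
    rw [hα.label_eq hA hx]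
  rw [h1, condExp_const (dirKronAlgQ_le μ T β)] at h
  filter_upwards [h] with x hx
  rw [Finset.sum_apply] at hx
  exact hx.symm

theorem IsPartition.sum_setIntegral {P : Finset (Set X)} (hP : IsPartition P) {f : X → ℝ}
    (hf : Integrable f μ) : ∑ D ∈ P, ∫ x in D, f x ∂μ = ∫ x, f x ∂μ := by
  have h := integral_biUnion_finset P (s := id) hP.1 hP.2.1 fun _ _ => hf.integrableOn
  have hU : ⋃ D ∈ P, id D = univ := by
    rw [← hP.2.2, sUnion_eq_biUnion]
    rfl
  rw [hU, setIntegral_univ] at h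
  exact h.symm

theorem sum_setIntegral_condP_comp (hα : IsPartition α) {S : X → X} (hS : MeasurePreserving S μ μ)
    (D : Set X) : ∑ A ∈ α, ∫ x in D, condP μ T β A (S x) ∂μ = μ.real D := by
  rw [← integral_finsetSum]
  · have : ∀ᵐ x ∂μ.restrict D, ∑ A ∈ α, condP μ T β A (S x) = 1 := ae_restrict_of_ae
      (hS.quasiMeasurePreserving.ae (sum_condP_ae_eq_one (T := T) (β := β) hα))
    rw [integral_congr_ae this]
    simp
  · exact fun A _ => (hS.integrable_comp_of_integrable integrable_condExp).integrableOn

theorem sum_setIntegral_condP_mul_log (hα : IsPartition α) {S : X → X}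
    (hS : MeasurePreserving S μ μ) (D : Set X) :
    ∑ A ∈ α, (∫ x in D, condP μ T β A (S x) ∂μ) * Real.log (μ.real D) =
      -Real.negMulLog (μ.real D) := by
  rw [← Finset.sum_mul, sum_setIntegral_condP_comp hα hS, Real.negMulLog, neg_mul, neg_neg]

theorem partEnt_add_condEntAlg_le (hα : IsPartition α) {P : Finset (Set X)} (hP : IsPartition P)
    {S : X → X} (hS : MeasurePreserving S μ μ) :
    partEnt μ P + condEntAlg μ (dirKronAlgQ μ T β) α ≤
      ∑ D ∈ P, ∑ A ∈ α, Real.negMulLog (∫ x in D, condP μ T β A (S x) ∂μ) := by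
  have hE : ∀ A, Measurable fun x => condP μ T β A (S x) := fun A =>
    (measurable_condP A).comp hS.measurable
  have hI : ∀ A ∈ α, ∀ᵐ x ∂μ, condP μ T β A (S x) ∈ Icc (0 : ℝ) 1 := fun A hA =>
    hS.quasiMeasurePreserving.ae (condP_mem_Icc (hα.1 A hA))
  have h1 : condEntAlg μ (dirKronAlgQ μ T β) α =
      ∑ D ∈ P, ∑ A ∈ α, ∫ x in D, Real.negMulLog (condP μ T β A (S x)) ∂μ := by
    rw [Finset.sum_comm]
    refine Finset.sum_congr rfl fun A hA => ?_
    rw [hP.sum_setIntegral (integrable_negMulLog (hE A) (hI A hA))]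
    have := integral_map (μ := μ) hS.measurable.aemeasurable (f := fun x => Real.negMulLog
      (condP μ T β A x)) (Real.continuous_negMulLog.measurable.comp
        (measurable_condP A)).aestronglyMeasurable
    rw [hS.map_eq] at this
    exact this
  rw [h1, partEnt, ← Finset.sum_add_distrib]
  refine Finset.sum_le_sum fun D _ => ?_
  have h2 := Finset.sum_le_sum fun A hA => setIntegral_negMulLog_le (hE A) (hI A hA) D
  rw [Finset.sum_add_distrib, sum_setIntegral_condP_mul_log hα hS] at h2
  rw [← measureReal_def]
  linarith

theorem exists_partEnt_joinPart_ge (hβ : β 0 = 1) (h0 : T 0 = _root_.id)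
    (hadd : ∀ v w, T (v + w) = T v ∘ T w) (hmp : ∀ w, MeasurePreserving (T w) μ μ)
    {b : Fin q → ℝ} (hb : ∀ i, i ≠ 0 → 0 < b i) (hα : IsPartition α) {P : Finset (Set X)}
    (hP : IsPartition P) {ε : ℝ} (hε : 0 < ε) (N : ℤ) :
    ∃ w ∈ LamQ β b, N < w 0 ∧
      partEnt μ P + condEntAlg μ (dirKronAlgQ μ T β) α - ε ≤ partEnt μ (joinPart (T w) P α) := by
  obtain ⟨r, hr, hrb⟩ : ∃ r > 0, ∀ i, i ≠ 0 → r ≤ b i / 2 := by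
    refine ⟨Finset.univ.inf' Finset.univ_nonempty fun i => if i = 0 then 1 else b i / 2, ?_,
      fun i hi => ?_⟩
    · rw [gt_iff_lt, Finset.lt_inf'_iff]
      intro i _
      split_ifs with h
      · exact one_pos
      · exact half_pos (hb i h)
    · refine (Finset.inf'_le _ (Finset.mem_univ i)).trans ?_
      rw [if_neg hi]
  obtain ⟨δ, hδ, H⟩ := exists_negMulLog_modulus
    (show 0 < ε / ((P.card : ℝ) * α.card + 1) by positivity)
  obtain ⟨w, hw, hN, hclose⟩ := exists_measure_inter_preimage_close (β := β) (μ := μ) hβ h0 hadd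
    hmp hα.1 hP.1 hδ hr N
  refine ⟨w, fun i hi => ?_, hN, ?_⟩
  · have := (norm_dev_le_iff β w hr.le).mp hw i
    have := hrb i hi
    constructor <;> linarith
  have h1 := partEnt_add_condEntAlg_le (T := T) (β := β) hα hP (hmp w)
  rw [partEnt_joinPart (hmp w).measurable hP hα]
  have h2 : ∑ D ∈ P, ∑ A ∈ α, Real.negMulLog (∫ x in D, condP μ T β A (T w x) ∂μ) ≤
      ∑ D ∈ P, ∑ A ∈ α, (Real.negMulLog (μ.real (D ∩ T w ⁻¹' A)) +
        ε / ((P.card : ℝ) * α.card + 1)) := by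
    refine Finset.sum_le_sum fun D hD => Finset.sum_le_sum fun A hA => ?_
    have hI : ∀ᵐ x ∂μ, condP μ T β A (T w x) ∈ Icc (0 : ℝ) 1 :=
      (hmp w).quasiMeasurePreserving.ae (condP_mem_Icc (hα.1 A hA))
    have hz : (∫ x in D, condP μ T β A (T w x) ∂μ) ∈ Icc (0 : ℝ) 1 := by
      refine ⟨integral_nonneg_of_ae (ae_restrict_of_ae (hI.mono fun x hx => hx.1)), ?_⟩
      rw [← one_mul (1 : ℝ)]
      calc _ ≤ ∫ x in D, (1 : ℝ) ∂μ := integral_mono_ae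
            (integrable_of_mem_Icc ((measurable_condP A).comp (hmp w).measurable) hI).integrableOn
            (integrable_const _) (ae_restrict_of_ae (hI.mono fun x hx => hx.2))
        _ ≤ 1 * 1 := by
          rw [setIntegral_const, smul_eq_mul]
          gcongr
          exact measureReal_le_one
    have := (abs_le.mp (H _ ⟨measureReal_nonneg, measureReal_le_one⟩ _ hz
      (hclose D hD A hA).le)).1
    linarith
  simp only [Finset.sum_add_distrib, Finset.sum_const, nsmul_eq_mul] at h2
  have h3 : (P.card : ℝ) * (α.card * (ε / ((P.card : ℝ) * α.card + 1))) ≤ ε := by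
    rw [← mul_assoc, mul_div_assoc', div_le_iff₀ (by positivity)]
    nlinarith
  linarith

theorem isPartition_univ : IsPartition ({univ} : Finset (Set X)) :=
  ⟨by simp, by simp, by simp⟩

theorem seqJoin_succ {G : Type*} (T : G → X → X) (w : ℕ → G) (α : Finset (Set X)) (k : ℕ) :
    seqJoin T w α (k + 1) = joinPart (T (w k)) (seqJoin T w α k) α := by
  rw [joinPart, seqJoin]

theorem IsPartition.seqJoin {G : Type*} {T : G → X → X} (hT : ∀ w, Measurable (T w)) (w : ℕ → G)
    (hα : IsPartition α) (k : ℕ) : IsPartition (seqJoin T w α k) := by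
  induction k with
  | zero => exact isPartition_univ
  | succ k ih =>
    rw [seqJoin_succ]
    exact ih.joinPart (hT _) hα

theorem exists_partEnt_seqJoin_ge (hβ : β 0 = 1) (h0 : T 0 = _root_.id)
    (hadd : ∀ v w, T (v + w) = T v ∘ T w) (hmp : ∀ w, MeasurePreserving (T w) μ μ)
    {b : Fin q → ℝ} (hb : ∀ i, i ≠ 0 → 0 < b i) (hα : IsPartition α) :
    ∃ w : ℕ → Fin q → ℤ, (∀ k, w k ∈ LamQ β b) ∧ StrictMono (fun k => w k 0) ∧
      ∀ k : ℕ, k * condEntAlg μ (dirKronAlgQ μ T β) α - 2 ≤ partEnt μ (seqJoin T w α k) := by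
  set c := condEntAlg μ (dirKronAlgQ μ T β) α
  have step : ∀ (P : {P : Finset (Set X) // IsPartition P}) (N : ℤ) (k : ℕ), ∃ w ∈ LamQ β b,
      N < w 0 ∧ partEnt μ P.1 + c - (1 / 2) ^ k ≤ partEnt μ (joinPart (T w) P.1 α) :=
    fun P N k => exists_partEnt_joinPart_ge hβ h0 hadd hmp hb hα P.2 (by positivity) N
  choose next hmem hlt hge using step
  let st : ℕ → {P : Finset (Set X) // IsPartition P} × ℤ := fun k => Nat.rec
    (⟨{univ}, isPartition_univ⟩, 0) (fun k s => (⟨joinPart (T (next s.1 s.2 k)) s.1.1 α,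
      s.1.2.joinPart (hmp _).measurable hα⟩, next s.1 s.2 k 0)) k
  set w : ℕ → Fin q → ℤ := fun k => next (st k).1 (st k).2 k
  have hP : ∀ k, ((st k).1 : Finset (Set X)) = seqJoin T w α k := by
    intro k
    induction k with
    | zero => rfl
    | succ k ih =>
      rw [seqJoin_succ, ← ih]
  refine ⟨w, fun k => hmem _ _ _, strictMono_nat_of_lt_succ fun k => ?_, fun k => ?_⟩
  · exact hlt (st (k + 1)).1 (st (k + 1)).2 (k + 1)
  · have key : k * c - (2 - 2 * (1 / 2) ^ k) ≤ partEnt μ (seqJoin T w α k) := by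
      induction k with
      | zero => simp [seqJoin, partEnt]
      | succ k ih =>
        have := hge (st k).1 (st k).2 k
        rw [hP] at this
        rw [seqJoin_succ]
        refine le_trans ?_ this
        push_cast
        rw [pow_succ]
        linarith
    have : (0 : ℝ) ≤ 2 * (1 / 2) ^ k := by positivity
    linarith

end Gain

/-! ### The upper bound for sequence entropy -/

section Bound

variable {X : Type*} [mX : MeasurableSpace X] {μ : Measure X} [IsProbabilityMeasure μ]

theorem exists_quantization {X : Type*} [MeasurableSpace X] {ι : Type*} [Fintype ι]
    {E : ι → X → ℝ} (hE : ∀ i, Measurable (E i)) {δ : ℝ} (hδ : 0 < δ) :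
    ∃ (N : ℕ) (η : X → ι → Fin N) (t : Fin N → ℝ), DiscMeasurable η ∧
      ∀ x i, E i x ∈ Icc (0 : ℝ) 1 → E i x ∈ Icc (t (η x i)) (t (η x i) + δ) := by
  obtain ⟨n, hn⟩ := exists_nat_one_div_lt hδ
  set N : ℝ := (n : ℝ) + 1
  have hN : 0 < N := by positivity
  let Q : ℝ → Fin (n + 2) := fun y => ⟨min ⌊N * y⌋₊ (n + 1), by omega⟩
  refine ⟨n + 2, fun x i => Q (E i x), fun j => (j : ℕ) / N, .pi fun i s => ?_, fun x i hx => ?_⟩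
  · have hQ : Measurable Q := by
      have h1 : Measurable fun y : ℝ => ⌊N * y⌋₊ :=
        Nat.measurable_floor.comp (measurable_id.const_mul N)
      exact (measurable_from_nat (f := fun k : ℕ => (⟨min k (n + 1), by omega⟩ : Fin (n + 2)))).comp
        h1
    exact (hQ.comp (hE i)) (.of_discrete (s := s))
  · have h0 : 0 ≤ N * E i x := mul_nonneg hN.le hx.1
    have h1 : ⌊N * E i x⌋₊ ≤ n + 1 := by
      refine Nat.floor_le_of_le ?_
      push_cast
      exact mul_le_of_le_one_right hN.le hx.2
    have h2 : ((Q (E i x) : ℕ) : ℝ) = ⌊N * E i x⌋₊ := by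
      simp only [Q, min_eq_left h1]
    beta_reduce
    rw [h2]
    constructor
    · rw [div_le_iff₀' hN]
      exact Nat.floor_le h0
    · have h3 := Nat.lt_floor_add_one (N * E i x)
      have h4 : E i x < (⌊N * E i x⌋₊ + 1) / N := by rwa [lt_div_iff₀' hN]
      rw [add_div] at h4
      linarith

theorem ent_itinerary_le {G ι κ : Type*} [Fintype ι] [Fintype κ] {T : G → X → X}
    (hmp : ∀ w, MeasurePreserving (T w) μ μ) (w : ℕ → G) {f : X → ι} {g : X → κ}
    (hf : DiscMeasurable f) (hg : DiscMeasurable g) {m : ℕ} (c : G → Fin m) {ε : ℝ}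
    (hε : 0 ≤ ε) (hc : ∀ i j, c (w i) = c (w j) → condEnt μ (g ∘ T (w i)) (g ∘ T (w j)) ≤ ε)
    (k : ℕ) : ent μ (fun x (i : Fin k) => (f (T (w i) x), g (T (w i) x))) ≤
      k * (condEnt μ f g + ε) + Fintype.card κ * m := by
  set Z : ∀ k, X → Fin k → ι × κ := fun k x i => (f (T (w i) x), g (T (w i) x)) with hZ
  have hZm : ∀ k, DiscMeasurable (Z k) := fun k => .pi fun i =>
    (hf.prodMk hg).comp_measurable (hmp (w i)).measurable
  set used : ℕ → Finset (Fin m) := fun k => (Finset.range k).image fun i => c (w i) with hused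
  have key : ∀ k, ent μ (Z k) ≤ k * (condEnt μ f g + ε) + Fintype.card κ * (used k).card := by
    intro k
    induction k with
    | zero =>
      have : ent μ (Z 0) = 0 := by
        rw [ent]
        refine Finset.sum_eq_zero fun i _ => ?_
        have : Z 0 ⁻¹' {i} = univ := eq_univ_of_forall fun x => Subsingleton.elim _ _
        simp [this]
      simp [this, hused]
    | succ k ih =>
      have hfk := hf.comp_measurable (hmp (w k)).measurable
      have hgk := hg.comp_measurable (hmp (w k)).measurable
      have h1 : ent μ (Z (k + 1)) =
          ent μ (fun x => ((f ∘ T (w k)) x, ((g ∘ T (w k)) x, Z k x))) := by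
        refine ent_congr (hZm _) (hfk.prodMk (hgk.prodMk (hZm k))) fun x y => ?_
        simp only [Prod.mk.injEq, Function.comp_apply]
        rw [funext_iff, Fin.forall_fin_succ', funext_iff]
        simp only [hZ, Prod.mk.injEq, Fin.val_last, Fin.val_castSucc]
        tauto
      have h2 : condEnt μ (f ∘ T (w k)) (fun x => ((g ∘ T (w k)) x, Z k x)) ≤ condEnt μ f g := by
        rw [← condEnt_comp (hmp (w k)) hf hg]
        exact condEnt_le_of_determines hfk (hgk.prodMk (hZm k)) hgk fun x y h =>
          (Prod.mk.inj h).1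
      have h3 : condEnt μ (g ∘ T (w k)) (Z k) ≤
          ε + Fintype.card κ * ((used (k + 1)).card - (used k).card) := by
        have hsucc : used (k + 1) = insert (c (w k)) (used k) := by
          simp only [hused, Finset.range_add_one, Finset.image_insert]
        by_cases hold : c (w k) ∈ used k
        · rw [hsucc, Finset.insert_eq_of_mem hold, sub_self, mul_zero, add_zero]
          obtain ⟨j, hj, hjk⟩ := Finset.mem_image.mp hold
          refine le_trans (condEnt_le_of_determines hgk (hZm k)
            (hg.comp_measurable (hmp (w j)).measurable) fun x y h => ?_) (hc k j hjk.symm)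
          exact (Prod.mk.inj (congrFun h ⟨j, Finset.mem_range.mp hj⟩)).2
        · rw [hsucc, Finset.card_insert_of_notMem hold]
          have := condEnt_le_card (μ := μ) hgk (hZm k)
          push_cast
          linarith
      rw [condEnt] at h2 h3
      rw [h1]
      push_cast
      linarith
  refine (key k).trans ?_
  gcongr
  exact (Finset.card_le_univ _).trans_eq (Fintype.card_fin m)

theorem partEnt_seqJoin_le_ent {G ι : Type*} [Fintype ι] {T : G → X → X}
    (hT : ∀ w, Measurable (T w)) (w : ℕ → G) {α : Finset (Set X)} (hα : IsPartition α) {k : ℕ}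
    {Z : X → ι} (hZ : DiscMeasurable Z)
    (h : ∀ x y, Z x = Z y → ∀ i < k, hα.label (T (w i) x) = hα.label (T (w i) y)) :
    partEnt μ (seqJoin T w α k) ≤ ent μ Z := by
  rw [(hα.seqJoin hT w k).partEnt_eq_ent]
  have key : ∀ x y, ∀ k, (∀ i < k, hα.label (T (w i) x) = hα.label (T (w i) y)) →
      ∃ D ∈ seqJoin T w α k, x ∈ D ∧ y ∈ D := by
    intro x y k
    induction k with
    | zero => exact fun _ => ⟨univ, by simp [seqJoin], mem_univ _, mem_univ _⟩
    | succ k ih =>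
      intro hk
      obtain ⟨D, hD, hx, hy⟩ := ih fun i hi => hk i (hi.trans k.lt_succ_self)
      rw [seqJoin_succ]
      refine ⟨_, mem_joinPart.mpr ⟨D, hD, _, (hα.label (T (w k) x)).2, rfl⟩,
        ⟨hx, hα.mem_label _⟩, ⟨hy, ?_⟩⟩
      rw [hk k k.lt_succ_self]
      exact hα.mem_label _
  refine ent_le_of_determines hZ fun x y hxy => ?_
  obtain ⟨D, hD, hx, hy⟩ := key x y k (h x y hxy)
  rw [(hα.seqJoin hT w k).label_eq hD hx, (hα.seqJoin hT w k).label_eq hD hy]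

variable {q : ℕ} [NeZero q] {T : (Fin q → ℤ) → X → X} {β : Fin q → ℝ} {α : Finset (Set X)}

theorem condEnt_label_le (hα : IsPartition α) {κ : Type*} [Fintype κ] {η : X → κ}
    (hη : ∀ s, MeasurableSet[dirKronAlgQ μ T β] (η ⁻¹' s)) {t : κ → α → ℝ} {ε δ : ℝ}
    (H : ∀ x ∈ Icc (0 : ℝ) 1, ∀ y ∈ Icc (0 : ℝ) 1, |x - y| ≤ δ →
      |Real.negMulLog x - Real.negMulLog y| ≤ ε)
    (ht : ∀ x (A : α), condP μ T β A x ∈ Icc (0 : ℝ) 1 →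
      condP μ T β A x ∈ Icc (t (η x) A) (t (η x) A + δ)) :
    condEnt μ hα.label η ≤ condEntAlg μ (dirKronAlgQ μ T β) α + α.card * ε := by
  have hηm : ∀ s, MeasurableSet (η ⁻¹' s) := fun s => dirKronAlgQ_le μ T β _ (hη s)
  have hsum : ∀ f : X → ℝ, Integrable f μ → ∑ j, ∫ x in η ⁻¹' {j}, f x ∂μ = ∫ x, f x ∂μ := by
    intro f hf
    rw [← integral_iUnion_fintype (fun j => hηm {j}) (fun i j hij =>
      (disjoint_singleton.mpr hij).preimage η) fun _ => hf.integrableOn, ← preimage_iUnion,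
      iUnion_of_singleton, preimage_univ, setIntegral_univ]
  have hI : ∀ A : α, ∀ᵐ x ∂μ, condP μ T β A x ∈ Icc (0 : ℝ) 1 := fun A =>
    condP_mem_Icc (hα.1 A A.2)
  have h1 : ∀ j, (∑ A : α, Real.negMulLog (μ.real (hα.label ⁻¹' {A} ∩ η ⁻¹' {j}))) -
      Real.negMulLog (μ.real (η ⁻¹' {j})) ≤
      ∑ A : α, ((∫ x in η ⁻¹' {j}, Real.negMulLog (condP μ T β A x) ∂μ) +
        ε * μ.real (η ⁻¹' {j})) := by
    intro j
    have h2 := sum_setIntegral_condP_mul_log (T := T) (β := β) hα (MeasurePreserving.id μ)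
      (η ⁻¹' {j})
    rw [← Finset.sum_coe_sort α] at h2
    rw [sub_eq_add_neg, ← h2, ← Finset.sum_add_distrib]
    refine Finset.sum_le_sum fun A _ => ?_
    have h3 : μ.real (hα.label ⁻¹' {A} ∩ η ⁻¹' {j}) =
        ∫ x in η ⁻¹' {j}, condP μ T β A x ∂μ := by
      rw [condP, setIntegral_condExp (dirKronAlgQ_le μ T β)
        (integrable_indicator_one (hα.1 A A.2)) (hη {j}), setIntegral_indicator (hα.1 A A.2),
        hα.label_preimage, inter_comm]
      simp
    rw [h3]
    refine le_setIntegral_negMulLog (measurable_condP _) (hI A) H (t j A) ?_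
    filter_upwards [ae_restrict_mem (hηm {j}), ae_restrict_of_ae (hI A)] with x hx hx'
    have := ht x A hx'
    rwa [(hx : η x = j)] at this
  rw [condEnt_eq_sum]
  refine (Finset.sum_le_sum fun j _ => h1 j).trans_eq ?_
  rw [Finset.sum_comm, condEntAlg, ← Finset.sum_coe_sort α]
  have h4 : ∑ j, μ.real (η ⁻¹' {j}) = 1 := by
    have := hsum (fun _ => 1) (integrable_const 1)
    simpa using this
  simp only [Finset.sum_add_distrib, ← Finset.mul_sum, h4, Finset.sum_const, Finset.card_univ,
    Fintype.card_coe, nsmul_eq_mul, mul_one]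
  congr 1
  exact Finset.sum_congr rfl fun A _ =>
    hsum _ (integrable_negMulLog (measurable_condP _) (hI A))

theorem exists_partEnt_seqJoin_le (hβ : β 0 = 1) (hadd : ∀ v w, T (v + w) = T v ∘ T w)
    (hmp : ∀ w, MeasurePreserving (T w) μ μ) (hα : IsPartition α) {b : Fin q → ℝ}
    {w : ℕ → Fin q → ℤ} (hw : ∀ i, w i ∈ LamQ β b) {ε : ℝ} (hε : 0 < ε) :
    ∃ K : ℝ, ∀ k : ℕ, partEnt μ (seqJoin T w α k) ≤
      k * (condEntAlg μ (dirKronAlgQ μ T β) α + ε) + K := by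
  set ε' : ℝ := ε / (α.card + 1) with hε'
  have hε'0 : 0 < ε' := by positivity
  obtain ⟨δ, hδ, H⟩ := exists_negMulLog_modulus hε'0
  obtain ⟨N, η, t, hη, ht⟩ := @exists_quantization X (dirKronAlgQ μ T β) α _
    (fun A => condP μ T β A) (fun A => (stronglyMeasurable_condP (A : Set X)).measurable) δ hδ
  have hηm : DiscMeasurable η := fun s => dirKronAlgQ_le μ T β _ (hη s)
  have h1 := condEnt_label_le hα hη (t := fun v A => t (v A)) H fun x A => ht x A
  obtain ⟨ρ, hρ, hclose⟩ := exists_condEnt_le (X := X) (α → Fin N) hε'0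
  obtain ⟨m, c, hc⟩ := FinColorable.sum (fun j => finColorable_orbitDist_LamQ (μ := μ) hβ hadd hmp
    (hη {j}) b) ρ hρ
  refine ⟨Fintype.card (α → Fin N) * m, fun k => ?_⟩
  have h2 := ent_itinerary_le hmp w hα.discMeasurable_label hηm c hε'0.le (fun i j hij => by
    refine hclose μ _ _ (hηm.comp_measurable (hmp _).measurable) fun a => ?_
    refine le_trans ?_ (hc _ (hw i) _ (hw j) hij)
    exact Finset.single_le_sum (f := fun a => orbitDist μ T (η ⁻¹' {a}) (w i) (w j))
      (fun _ _ => measureReal_nonneg) (Finset.mem_univ a)) k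
  refine (partEnt_seqJoin_le_ent (fun w => (hmp w).measurable) w hα (.pi (ι := Fin k) fun i =>
    (hα.discMeasurable_label.prodMk hηm).comp_measurable (hmp (w i)).measurable)
    fun x y h i hi => (Prod.mk.inj (congrFun h ⟨i, hi⟩)).1).trans (h2.trans ?_)
  refine add_le_add (mul_le_mul_of_nonneg_left ?_ k.cast_nonneg) le_rfl
  have h3 : α.card * ε' + ε' = ε := by
    rw [hε']
    field_simp
  linarith

theorem partEnt_nonneg (P : Finset (Set X)) : 0 ≤ partEnt μ P :=
  Finset.sum_nonneg fun _ _ => Real.negMulLog_nonneg measureReal_nonneg measureReal_le_one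

theorem limsup_div_nat_le {H : ℕ → ℝ} (h0 : ∀ k, 0 ≤ H k) {c : ℝ}
    (h : ∀ ε > 0, ∃ K : ℝ, ∀ k : ℕ, H k ≤ k * (c + ε) + K) :
    limsup (fun k : ℕ => H k / (k : ℝ)) atTop ≤ c := by
  refine le_of_forall_pos_le_add fun ε hε => ?_
  obtain ⟨K, hK⟩ := h (ε / 2) (by positivity)
  have hcob : IsCoboundedUnder (· ≤ ·) atTop fun k : ℕ => H k / (k : ℝ) :=
    (isBoundedUnder_of ⟨0, fun k => div_nonneg (h0 k) k.cast_nonneg⟩ :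
      IsBoundedUnder (· ≥ ·) atTop fun k : ℕ => H k / (k : ℝ)).isCoboundedUnder_le
  refine limsup_le_of_le hcob ?_
  have hlim : Tendsto (fun k : ℕ => K / (k : ℝ)) atTop (𝓝 0) :=
    tendsto_const_div_atTop_nhds_zero_nat K
  filter_upwards [hlim.eventually (ge_mem_nhds (half_pos hε)), eventually_gt_atTop 0] with k hk h0k
  have hk0 : (0 : ℝ) < k := Nat.cast_pos.mpr h0k
  rw [div_le_iff₀ hk0] at hk ⊢
  have := hK k
  nlinarith

theorem le_limsup_div_nat {H : ℕ → ℝ} {c C K : ℝ} (hC : ∀ k : ℕ, H k ≤ k * C + K)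
    (h : ∀ k : ℕ, k * c - K ≤ H k) : c ≤ limsup (fun k : ℕ => H k / (k : ℝ)) atTop := by
  have hlim : Tendsto (fun k : ℕ => K / (k : ℝ)) atTop (𝓝 0) :=
    tendsto_const_div_atTop_nhds_zero_nat K
  have hbdd : IsBoundedUnder (· ≤ ·) atTop fun k : ℕ => H k / (k : ℝ) := by
    refine ⟨C + 1, eventually_map.mpr ?_⟩
    filter_upwards [hlim.eventually (ge_mem_nhds one_pos), eventually_gt_atTop 0] with k hk h0k
    have hk0 : (0 : ℝ) < k := Nat.cast_pos.mpr h0k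
    rw [div_le_iff₀ hk0] at hk ⊢
    have := hC k
    nlinarith
  refine le_of_forall_pos_le_add fun ε hε => ?_
  rw [← sub_le_iff_le_add]
  refine le_limsup_of_frequently_le (Eventually.frequently ?_) hbdd
  filter_upwards [hlim.eventually (ge_mem_nhds hε), eventually_gt_atTop 0] with k hk h0k
  have hk0 : (0 : ℝ) < k := Nat.cast_pos.mpr h0k
  rw [div_le_iff₀ hk0] at hk
  rw [le_div_iff₀ hk0]
  have := h k
  nlinarith

end Bound

/-- for a `ℤ^q`-system, (i) every directional sequence entropy of
`α` along the tube is at most `H_μ(α | 𝒦^v_μ)`, and (ii) this bound is attained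
along some infinite subset with strictly monotone first coordinates. -/
theorem seqEntQ_le_and_attained
    {X : Type*} [MetricSpace X] [CompactSpace X] [MeasurableSpace X] [BorelSpace X]
    (q : ℕ) [NeZero q] (hq : 2 ≤ q)
    (μ : Measure X) [IsProbabilityMeasure μ] (T : (Fin q → ℤ) → X → X)
    (hT : IsZqMPS μ T) (β : Fin q → ℝ) (hβ : β 0 = 1)
    (b : Fin q → ℝ) (hb : ∀ i : Fin q, i ≠ 0 → 0 < b i)
    (α : Finset (Set X)) (hα : IsPartition α) :
    (∀ w : ℕ → Fin q → ℤ, EnumIn w (LamQ β b) →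
        seqEnt μ T w α ≤ condEntAlg μ (dirKronAlgQ μ T β) α) ∧
    (∃ w : ℕ → Fin q → ℤ, EnumIn w (LamQ β b) ∧
        (StrictMono (fun i => w i 0) ∨ StrictAnti (fun i => w i 0)) ∧
        seqEnt μ T w α = condEntAlg μ (dirKronAlgQ μ T β) α) := by
  obtain ⟨-, h0, hadd, hmp⟩ := hT
  have hle : ∀ w : ℕ → Fin q → ℤ, EnumIn w (LamQ β b) →
      seqEnt μ T w α ≤ condEntAlg μ (dirKronAlgQ μ T β) α := fun w hw =>
    limsup_div_nat_le (fun _ => partEnt_nonneg _) fun _ hε =>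
      exists_partEnt_seqJoin_le hβ hadd hmp hα hw.2 hε
  obtain ⟨w, hw, hmono, hge⟩ := exists_partEnt_seqJoin_ge hβ h0 hadd hmp hb hα
  have hinj : Function.Injective w := fun i j hij => hmono.injective (congrFun hij 0)
  refine ⟨hle, w, ⟨hinj, hw⟩, Or.inl hmono, (hle w ⟨hinj, hw⟩).antisymm ?_⟩
  obtain ⟨K, hK⟩ := exists_partEnt_seqJoin_le hβ hadd hmp hα hw one_pos
  exact le_limsup_div_nat (K := max K 2) (fun k => (hK k).trans (by gcongr; exact le_max_left _ _))
    fun k => (sub_le_sub_left (le_max_right _ _) _).trans (hge k)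

end Directional
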